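/- Let N = 2, let q ∈ ℂ* be not a root of unity (or q = 1), and let ξ = diag(ξ₁, ξ₂). If ξ₁ − ξ₂, ξ₁ − q²ξ₂, …, ξ₁ − q^{2m−2}ξ₂ are all non-zero and ξ₁ − q^{2m}ξ₂ = 0, then the kernel of the co-orbit map β^ξ equals the sum of the right ideal (τ₁ − τ₁(ξ))·O(M_q) + (τ₂ − τ₂(ξ))·O(M_q) and the O(GL_q)-subcomodule of (O(M_q), β) generated by the powers x_{21}^k with k > m. -/

import Mathlib

open TensorProduct

noncomputable section

/-- Number of inversions (the length) of a permutation of `Fin t`. -/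
def invCount {t : ℕ} (σ : Equiv.Perm (Fin t)) : ℕ :=
  (Finset.univ.filter fun p : Fin t × Fin t => p.1 < p.2 ∧ σ p.2 < σ p.1).card

/-- The principal quantum minor `[I|I]` of the matrix of generators `x`. -/
def qMinor {A : Type} [CommRing A] {M : Type} [Ring M] [Algebra A M] {N : ℕ}
    (q : A) (x : Fin N → Fin N → M) (I : Finset (Fin N)) : M :=
  ∑ σ : Equiv.Perm (Fin I.card),
    ((-q) ^ invCount σ) •
      ((List.finRange I.card).map fun k =>
        x ((I.orderIsoOfFin rfl) k).1 ((I.orderIsoOfFin rfl) (σ k)).1).prod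

/-- The quantum determinant. -/
def qdet {A : Type} [CommRing A] {M : Type} [Ring M] [Algebra A M] {N : ℕ}
    (q : A) (x : Fin N → Fin N → M) : M :=
  qMinor q x Finset.univ

/-- `w(I)`: the sum of the elements of `I` (with `{1, …, N}` indexing). -/
def wtSet {N : ℕ} (I : Finset (Fin N)) : ℕ := ∑ j ∈ I, (j.1 + 1)

/-- The weighted sum `τ_i` of principal quantum minors of size `i`. -/
def tauCoinv {A : Type} [CommRing A] {M : Type} [Ring M] [Algebra A M] {N : ℕ}
    (q qinv : A) (x : Fin N → Fin N → M) (i : ℕ) : M :=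
  ∑ I ∈ Finset.univ.filter (fun I : Finset (Fin N) => I.card = i),
    qinv ^ (2 * wtSet I) • qMinor q x I

/-- The sum `σ_i` of all principal quantum minors of size `i`. -/
def sigmaCoinv {A : Type} [CommRing A] {M : Type} [Ring M] [Algebra A M] {N : ℕ}
    (q : A) (x : Fin N → Fin N → M) (i : ℕ) : M :=
  ∑ I ∈ Finset.univ.filter (fun I : Finset (Fin N) => I.card = i), qMinor q x I

/-- The right adjoint coaction `β(h) = Σ h₂ ⊗ S(h₁)h₃`. -/
def adjBeta {A : Type} [CommRing A] {M G : Type} [Ring M] [Algebra A M] [Ring G] [Algebra A G]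
    (ΔM : M →ₐ[A] M ⊗[A] M) (ι : M →ₐ[A] G) (St : G →ₗ[A] G) : M →ₗ[A] M ⊗[A] G :=
  TensorProduct.map LinearMap.id (LinearMap.mul' A G) ∘ₗ
  (TensorProduct.assoc A M G G).toLinearMap ∘ₗ
  TensorProduct.map
    ((TensorProduct.comm A G M).toLinearMap ∘ₗ
      TensorProduct.map (St ∘ₗ ι.toLinearMap) LinearMap.id)
    ι.toLinearMap ∘ₗ
  TensorProduct.map ΔM.toLinearMap LinearMap.id ∘ₗ ΔM.toLinearMap

/-- The right coaction `α(h) = Σ h₂ ⊗ h₃S(h₁)`. -/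
def adjAlpha {A : Type} [CommRing A] {M G : Type} [Ring M] [Algebra A M] [Ring G] [Algebra A G]
    (ΔM : M →ₐ[A] M ⊗[A] M) (ι : M →ₐ[A] G) (St : G →ₗ[A] G) : M →ₗ[A] M ⊗[A] G :=
  TensorProduct.map LinearMap.id (LinearMap.mul' A G) ∘ₗ
  TensorProduct.map LinearMap.id (TensorProduct.comm A G G).toLinearMap ∘ₗ
  (TensorProduct.assoc A M G G).toLinearMap ∘ₗ
  TensorProduct.map
    ((TensorProduct.comm A G M).toLinearMap ∘ₗ
      TensorProduct.map (St ∘ₗ ι.toLinearMap) LinearMap.id)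
    ι.toLinearMap ∘ₗ
  TensorProduct.map ΔM.toLinearMap LinearMap.id ∘ₗ ΔM.toLinearMap

/-- The co-orbit map associated to a point `e = ev_ξ` and a coaction `b`. -/
def coorbit {A : Type} [CommRing A] {M G : Type} [Ring M] [Algebra A M] [Ring G] [Algebra A G]
    (e : M →ₐ[A] A) (b : M →ₗ[A] M ⊗[A] G) : M →ₗ[A] G :=
  (TensorProduct.lid A G).toLinearMap ∘ₗ TensorProduct.map e.toLinearMap LinearMap.id ∘ₗ b

/-- The left coaction `λ_D = (π_D ⊗ id) ∘ Δ` of a quotient Hopf algebra. -/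
def leftCoact {A : Type} [CommRing A] {G D : Type} [Ring G] [Algebra A G]
    [CommRing D] [Algebra A D]
    (πD : G →ₐ[A] D) (ΔG : G →ₐ[A] G ⊗[A] G) : G →ₗ[A] D ⊗[A] G :=
  TensorProduct.map πD.toLinearMap LinearMap.id ∘ₗ ΔG.toLinearMap

/-- Coinvariants of the left coaction `λ_D`. -/
def dCoinv {A : Type} [CommRing A] {G D : Type} [Ring G] [Algebra A G]
    [CommRing D] [Algebra A D]
    (πD : G →ₐ[A] D) (ΔG : G →ₐ[A] G ⊗[A] G) : Set G :=
  {f : G | leftCoact πD ΔG f = (1 : D) ⊗ₜ[A] f}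

/-- The right coaction `ρ_D = (id ⊗ π_D) ∘ Δ`. -/
def rightCoact {A : Type} [CommRing A] {G D : Type} [Ring G] [Algebra A G]
    [CommRing D] [Algebra A D]
    (πD : G →ₐ[A] D) (ΔG : G →ₐ[A] G ⊗[A] G) : G →ₗ[A] G ⊗[A] D :=
  TensorProduct.map LinearMap.id πD.toLinearMap ∘ₗ ΔG.toLinearMap

/-- The weight space of weight `ta : D` for the grading induced by `ρ_D`. -/
def weightSpace' {A : Type} [CommRing A] {G D : Type} [Ring G] [Algebra A G]
    [CommRing D] [Algebra A D]
    (πD : G →ₐ[A] D) (ΔG : G →ₐ[A] G ⊗[A] G) (ta : D) : Submodule A G :=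
  LinearMap.ker (rightCoact πD ΔG - (TensorProduct.mk A G D).flip ta)

/-- The subcomodule generated by a subset `s` of the comodule `(M, b)`. -/
def comodGen {A : Type} [CommRing A] {M G : Type} [Ring M] [Algebra A M] [Ring G] [Algebra A G]
    (b : M →ₗ[A] M ⊗[A] G) (s : Set M) : Submodule A M :=
  sInf {W : Submodule A M | s ⊆ W ∧
    ∀ w ∈ W, b w ∈ LinearMap.range (TensorProduct.map W.subtype (LinearMap.id : G →ₗ[A] G))}

/-- An algebra `M` mapping to a Hopf algebra `G`, compatibly with comultiplications. -/
structure HopfPair (M G : Type) [Ring M] [Algebra ℂ M] [Ring G] [Algebra ℂ G] where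
  /-- The canonical map. -/
  ι : M →ₐ[ℂ] G
  /-- The comultiplication of `M`. -/
  comulM : M →ₐ[ℂ] M ⊗[ℂ] M
  /-- The comultiplication of `G`. -/
  comul : G →ₐ[ℂ] G ⊗[ℂ] G
  /-- The counit of `G`. -/
  counit : G →ₐ[ℂ] ℂ
  /-- The antipode of `G`. -/
  anti : G →ₗ[ℂ] G
  comul_ι : ∀ m, comul (ι m) = Algebra.TensorProduct.map ι ι (comulM m)
  anti_conv : LinearMap.mul' ℂ G ∘ₗ TensorProduct.map anti LinearMap.id ∘ₗ comul.toLinearMap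
      = Algebra.linearMap ℂ G ∘ₗ counit.toLinearMap
  conv_anti : LinearMap.mul' ℂ G ∘ₗ TensorProduct.map LinearMap.id anti ∘ₗ comul.toLinearMap
      = Algebra.linearMap ℂ G ∘ₗ counit.toLinearMap

namespace HopfPair

variable {M G : Type} [Ring M] [Algebra ℂ M] [Ring G] [Algebra ℂ G] (H : HopfPair M G)

/-- The entries of `X` are the matrix coefficients of a finite-dimensional corepresentation. -/
structure IsCorep {κ : Type} [Fintype κ] [DecidableEq κ] (X : κ → κ → M) : Prop where
  comul : ∀ i j, H.comulM (X i j) = ∑ k, X i k ⊗ₜ[ℂ] X k j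
  counit : ∀ i j, H.counit (H.ι (X i j)) = if i = j then 1 else 0

/-- The antipode restricted to `M`. -/
def S (m : M) : G := H.anti (H.ι m)

/-- `M` is spanned by matrix coefficients. -/
def SpannedByCoreps : Prop :=
  ∀ p : M → Prop, p 0 → (∀ a b, p a → p b → p (a + b)) → (∀ (c : ℂ) a, p a → p (c • a)) →
    (∀ (κ : Type) (_ : Fintype κ) (_ : DecidableEq κ) (X : κ → κ → M), H.IsCorep X →
      ∀ i j, p (X i j)) → ∀ a, p a

variable {H}

namespace IsCorep

variable {κ κ' : Type} [Fintype κ] [DecidableEq κ] [Fintype κ'] [DecidableEq κ']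
  {X : κ → κ → M} {Y : κ' → κ' → M}

lemma comul_ι (hX : H.IsCorep X) (i j : κ) :
    H.comul (H.ι (X i j)) = ∑ k, H.ι (X i k) ⊗ₜ[ℂ] H.ι (X k j) := by
  rw [H.comul_ι, hX.comul]
  simp [map_sum]

lemma sum_S_mul (hX : H.IsCorep X) (i j : κ) :
    ∑ k, H.S (X i k) * H.ι (X k j) = if i = j then 1 else 0 := by
  have h := LinearMap.congr_fun H.anti_conv (H.ι (X i j))
  simp only [LinearMap.comp_apply, AlgHom.toLinearMap_apply, hX.comul_ι, map_sum,
    TensorProduct.map_tmul, LinearMap.mul'_apply, hX.counit, LinearMap.id_apply] at h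
  simpa [S, apply_ite] using h

lemma sum_mul_S (hX : H.IsCorep X) (i j : κ) :
    ∑ k, H.ι (X i k) * H.S (X k j) = if i = j then 1 else 0 := by
  have h := LinearMap.congr_fun H.conv_anti (H.ι (X i j))
  simp only [LinearMap.comp_apply, AlgHom.toLinearMap_apply, hX.comul_ι, map_sum,
    TensorProduct.map_tmul, LinearMap.mul'_apply, hX.counit, LinearMap.id_apply] at h
  simpa [S, apply_ite] using h

/-- Uniqueness of inverse matrices, transported along an algebra map. -/
lemma eq_map_S (hX : H.IsCorep X) {B : Type*} [Ring B] [Algebra ℂ B] (f : G →ₐ[ℂ] B)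
    (Z : κ → κ → B) (hZ : ∀ i j, ∑ k, f (H.ι (X i k)) * Z k j = if i = j then 1 else 0)
    (i j : κ) : f (H.S (X i j)) = Z i j := by
  let A : Matrix κ κ B := fun i j => f (H.ι (X i j))
  let T : Matrix κ κ B := fun i j => f (H.S (X i j))
  have h1 : T * A = 1 := by
    ext i j
    rw [Matrix.mul_apply, Matrix.one_apply]
    simpa [T, A, apply_ite f] using congrArg f (hX.sum_S_mul i j)
  have h2 : A * Matrix.of Z = 1 := by
    ext i j
    rw [Matrix.mul_apply, Matrix.one_apply]
    exact hZ i j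
  have : T = Matrix.of Z := by
    rw [← mul_one T, ← h2, ← mul_assoc, h1, one_mul]
  exact congrFun (congrFun this i) j

lemma prod (hX : H.IsCorep X) (hY : H.IsCorep Y) :
    H.IsCorep (fun i j : κ × κ' => X i.1 j.1 * Y i.2 j.2) where
  comul i j := by
    simp only [map_mul, hX.comul, hY.comul, Finset.sum_mul_sum,
      Algebra.TensorProduct.tmul_mul_tmul, Fintype.sum_prod_type]
  counit i j := by
    simp only [map_mul, hX.counit, hY.counit, Prod.ext_iff]
    split_ifs <;> simp_all

lemma one : H.IsCorep (fun _ _ : Unit => (1 : M)) where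
  comul i j := by simp [Algebra.TensorProduct.one_def]
  counit i j := by simp

lemma S_mul (hX : H.IsCorep X) (hY : H.IsCorep Y) (i j : κ) (i' j' : κ') :
    H.S (X i j * Y i' j') = H.S (Y i' j') * H.S (X i j) := by
  refine (hX.prod hY).eq_map_S (AlgHom.id ℂ G)
    (fun i j => H.S (Y i.2 j.2) * H.S (X i.1 j.1)) (fun i j => ?_) (i, i') (j, j')
  simp only [AlgHom.id_apply, Fintype.sum_prod_type, map_mul]
  have h : ∀ a : κ, ∑ b, H.ι (X i.1 a) * H.ι (Y i.2 b) * (H.S (Y b j.2) * H.S (X a j.1))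
      = if i.2 = j.2 then H.ι (X i.1 a) * H.S (X a j.1) else 0 := by
    intro a
    have : ∀ b, H.ι (X i.1 a) * H.ι (Y i.2 b) * (H.S (Y b j.2) * H.S (X a j.1))
        = H.ι (X i.1 a) * (H.ι (Y i.2 b) * H.S (Y b j.2)) * H.S (X a j.1) := by
      intro b; simp only [mul_assoc]
    simp only [this]
    rw [← Finset.sum_mul, ← Finset.mul_sum, hY.sum_mul_S]
    split_ifs <;> simp
  simp only [h, Prod.ext_iff]
  by_cases h2 : i.2 = j.2
  · simp [h2, hX.sum_mul_S]
  · simp [h2]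

lemma comul_S (hX : H.IsCorep X) (i j : κ) :
    H.comul (H.S (X i j)) = ∑ k, H.S (X k j) ⊗ₜ[ℂ] H.S (X i k) := by
  refine hX.eq_map_S H.comul (fun i j => ∑ k, H.S (X k j) ⊗ₜ[ℂ] H.S (X i k)) (fun i j => ?_) i j
  simp only [hX.comul_ι, Finset.sum_mul_sum, Algebra.TensorProduct.tmul_mul_tmul]
  have h : ∀ b c : κ, ∑ a, (H.ι (X i b) * H.S (X c j)) ⊗ₜ[ℂ] (H.ι (X b a) * H.S (X a c))
      = if b = c then (H.ι (X i b) * H.S (X c j)) ⊗ₜ[ℂ] (1 : G) else 0 := by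
    intro b c
    rw [← TensorProduct.tmul_sum, hX.sum_mul_S]
    split_ifs <;> simp
  rw [Finset.sum_comm]
  have : ∀ b : κ, (∑ a, ∑ c, (H.ι (X i b) * H.S (X c j)) ⊗ₜ[ℂ] (H.ι (X b a) * H.S (X a c)))
      = (H.ι (X i b) * H.S (X b j)) ⊗ₜ[ℂ] (1 : G) := by
    intro b
    rw [Finset.sum_comm]
    simp [h]
  simp only [this]
  rw [← TensorProduct.sum_tmul, hX.sum_mul_S]
  split_ifs <;> simp [Algebra.TensorProduct.one_def]

end IsCorep

variable (H)

/-- The right adjoint coaction of a Hopf pair. -/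
abbrev β : M →ₗ[ℂ] M ⊗[ℂ] G := adjBeta H.comulM H.ι H.anti

variable {H}

lemma SpannedByCoreps.ext (hs : H.SpannedByCoreps) {V : Type*} [AddCommGroup V] [Module ℂ V]
    {f g : M →ₗ[ℂ] V}
    (h : ∀ (κ : Type) (_ : Fintype κ) (_ : DecidableEq κ) (X : κ → κ → M), H.IsCorep X →
      ∀ i j, f (X i j) = g (X i j)) : f = g := by
  ext a
  refine hs (fun a => f a = g a) (by simp) (fun a b ha hb => by simp [ha, hb])
    (fun c a ha => by simp [ha]) h a

/-- `p ⊗ g ↦ ∑ p Y_{kl} ⊗ S(Y_{ik}) g Y_{lj}`. -/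
def twist {κ : Type} [Fintype κ] (H : HopfPair M G) (Y : κ → κ → M) (i j : κ) : M ⊗[ℂ] G →ₗ[ℂ] M ⊗[ℂ] G :=
  ∑ k, ∑ l, TensorProduct.map (LinearMap.mulRight ℂ (Y k l))
    (LinearMap.mulLeft ℂ (H.S (Y i k)) ∘ₗ LinearMap.mulRight ℂ (H.ι (Y l j)))

lemma twist_tmul {κ : Type} [Fintype κ] (Y : κ → κ → M) (i j : κ) (p : M) (g : G) : H.twist Y i j (p ⊗ₜ g)
    = ∑ k, ∑ l, (p * Y k l) ⊗ₜ[ℂ] (H.S (Y i k) * (g * H.ι (Y l j))) := by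
  simp [twist, LinearMap.sum_apply]

section

variable {κ κ' : Type} [Fintype κ] [DecidableEq κ] [Fintype κ'] [DecidableEq κ']
  {X : κ → κ → M} {Y : κ' → κ' → M}

lemma IsCorep.β_apply (hX : H.IsCorep X) (i j : κ) :
    H.β (X i j) = ∑ k, ∑ l, X k l ⊗ₜ[ℂ] (H.S (X i k) * H.ι (X l j)) := by
  simp only [β, adjBeta, LinearMap.comp_apply, AlgHom.toLinearMap_apply, hX.comul, map_sum,
    TensorProduct.map_tmul, LinearMap.id_apply, TensorProduct.sum_tmul,
    LinearEquiv.coe_coe, TensorProduct.comm_tmul, TensorProduct.assoc_tmul,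
    LinearMap.mul'_apply]
  rw [Finset.sum_comm]
  rfl

lemma IsCorep.coorbit_apply (hX : H.IsCorep X) (e : M →ₐ[ℂ] ℂ) (i j : κ) :
    coorbit e H.β (X i j) = ∑ k, ∑ l, e (X k l) • (H.S (X i k) * H.ι (X l j)) := by
  simp only [coorbit, LinearMap.comp_apply, hX.β_apply, map_sum, TensorProduct.map_tmul,
    LinearEquiv.coe_coe, TensorProduct.lid_tmul, LinearMap.id_apply, AlgHom.toLinearMap_apply]

/-- The coorbit map is a comodule map. -/
lemma SpannedByCoreps.map_coorbit_β (hs : H.SpannedByCoreps) (e : M →ₐ[ℂ] ℂ) :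
    TensorProduct.map (coorbit e H.β) LinearMap.id ∘ₗ H.β
      = H.comul.toLinearMap ∘ₗ coorbit e H.β := by
  refine hs.ext fun κ _ _ X hX i j => ?_
  simp only [LinearMap.comp_apply, hX.β_apply, map_sum, TensorProduct.map_tmul,
    LinearMap.id_apply, hX.coorbit_apply, AlgHom.toLinearMap_apply, map_smul, map_mul, hX.comul_S,
    hX.comul_ι, Finset.sum_mul_sum, Algebra.TensorProduct.tmul_mul_tmul, TensorProduct.sum_tmul,
    TensorProduct.smul_tmul', Finset.smul_sum]
  calc _ = _ := Finset.sum_congr rfl fun a _ => Finset.sum_comm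
    _ = _ := Finset.sum_comm
    _ = _ := Finset.sum_congr rfl fun k _ => Finset.sum_congr rfl fun a _ => Finset.sum_comm
    _ = _ := Finset.sum_congr rfl fun k _ => Finset.sum_comm

lemma SpannedByCoreps.β_mul (hs : H.SpannedByCoreps) (hY : H.IsCorep Y) (a : M) (i j : κ') :
    H.β (a * Y i j) = H.twist Y i j (H.β a) := by
  suffices h : H.β ∘ₗ LinearMap.mulRight ℂ (Y i j) = H.twist Y i j ∘ₗ H.β from
    LinearMap.congr_fun h a
  refine hs.ext fun κ _ _ X hX i' j' => ?_
  simp only [LinearMap.comp_apply, LinearMap.mulRight_apply]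
  rw [(hX.prod hY).β_apply (i', i) (j', j), hX.β_apply]
  simp only [map_sum, twist_tmul, Fintype.sum_prod_type, hX.S_mul hY, map_mul]
  refine Finset.sum_congr rfl fun a _ => ?_
  rw [Finset.sum_comm]
  simp only [mul_assoc]

/-- `β` is linear with respect to left multiplication by coinvariants. -/
lemma SpannedByCoreps.β_coinv_mul (hs : H.SpannedByCoreps) {t : M} (ht : H.β t = t ⊗ₜ 1) (b : M) :
    H.β (t * b) = TensorProduct.map (LinearMap.mulLeft ℂ t) LinearMap.id (H.β b) := by
  suffices h : H.β ∘ₗ LinearMap.mulLeft ℂ t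
      = TensorProduct.map (LinearMap.mulLeft ℂ t) LinearMap.id ∘ₗ H.β from
    LinearMap.congr_fun h b
  refine hs.ext fun κ _ _ Y hY i j => ?_
  simp only [LinearMap.comp_apply, LinearMap.mulLeft_apply]
  rw [hs.β_mul hY, ht, twist_tmul, hY.β_apply]
  simp

lemma SpannedByCoreps.coorbit_coinv_mul (hs : H.SpannedByCoreps) (e : M →ₐ[ℂ] ℂ) {t : M}
    (ht : H.β t = t ⊗ₜ 1) (b : M) : coorbit e H.β (t * b) = e t • coorbit e H.β b := by
  simp only [coorbit, LinearMap.comp_apply, hs.β_coinv_mul ht]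
  induction H.β b using TensorProduct.induction_on with
  | zero => simp
  | tmul p g => simp [mul_smul]
  | add u v hu hv => simp only [map_add, hu, hv, smul_add]

lemma SpannedByCoreps.coorbit_mul (hs : H.SpannedByCoreps) (e : M →ₐ[ℂ] ℂ) (hY : H.IsCorep Y)
    (a : M) (i j : κ') : coorbit e H.β (a * Y i j)
      = ∑ k, ∑ l, e (Y k l) • (H.S (Y i k) * (coorbit e H.β a * H.ι (Y l j))) := by
  simp only [coorbit, LinearMap.comp_apply, hs.β_mul hY]
  induction H.β a using TensorProduct.induction_on with
  | zero => simp
  | tmul p g => simp [twist_tmul, mul_smul, smul_comm (e p)]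
  | add u v hu hv => simp only [map_add, hu, hv, smul_add, mul_add, add_mul,
      Finset.sum_add_distrib]

end

/-- Contraction of the second tensor factor by a functional. -/
def slice {N : Type} [AddCommGroup N] [Module ℂ N] (φ : G →ₗ[ℂ] ℂ) : N ⊗[ℂ] G →ₗ[ℂ] N :=
  (TensorProduct.rid ℂ N).toLinearMap ∘ₗ TensorProduct.map LinearMap.id φ

@[simp] lemma slice_tmul {N : Type} [AddCommGroup N] [Module ℂ N] (φ : G →ₗ[ℂ] ℂ) (p : N) (g : G) :
    slice φ (p ⊗ₜ[ℂ] g) = φ g • p := by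
  simp [slice]

lemma slice_map {N N' : Type} [AddCommGroup N] [Module ℂ N] [AddCommGroup N'] [Module ℂ N']
    (φ : G →ₗ[ℂ] ℂ) (f : N →ₗ[ℂ] N') (u : N ⊗[ℂ] G) :
    slice φ (TensorProduct.map f LinearMap.id u) = f (slice φ u) := by
  induction u using TensorProduct.induction_on with
  | zero => simp
  | tmul p g => simp
  | add u v hu hv => simp only [map_add, hu, hv]

variable (H)

/-- The operator on `M` induced by a functional on `G` through `β`. -/
def adOp (φ : G →ₗ[ℂ] ℂ) : M →ₗ[ℂ] M := slice φ ∘ₗ H.β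

/-- The right regular operator on `G` induced by a functional on `G`. -/
def regOp (φ : G →ₗ[ℂ] ℂ) : G →ₗ[ℂ] G := slice φ ∘ₗ H.comul.toLinearMap

variable {H}

lemma SpannedByCoreps.coorbit_adOp (hs : H.SpannedByCoreps) (e : M →ₐ[ℂ] ℂ) (φ : G →ₗ[ℂ] ℂ)
    (u : M) : coorbit e H.β (H.adOp φ u) = H.regOp φ (coorbit e H.β u) := by
  have h := LinearMap.congr_fun (hs.map_coorbit_β e) u
  simp only [LinearMap.comp_apply] at h
  rw [adOp, regOp, LinearMap.comp_apply, LinearMap.comp_apply, ← h, slice_map]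

lemma SpannedByCoreps.adOp_coinv_mul (hs : H.SpannedByCoreps) {t : M}
    (ht : H.β t = t ⊗ₜ 1) (φ : G →ₗ[ℂ] ℂ) (b : M) :
    H.adOp φ (t * b) = t * H.adOp φ b := by
  simp only [adOp, LinearMap.comp_apply, hs.β_coinv_mul ht, slice_map, LinearMap.mulLeft_apply]

lemma adOp_mem_comodGen (s : Set M) (φ : G →ₗ[ℂ] ℂ) {u : M} (hu : u ∈ comodGen H.β s) :
    H.adOp φ u ∈ comodGen H.β s := by
  simp only [comodGen, Submodule.mem_sInf, Set.mem_ofPred_eq] at hu ⊢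
  intro W hW
  obtain ⟨z, hz⟩ := hW.2 u (hu W hW)
  rw [adOp, LinearMap.comp_apply, ← hz, slice_map]
  exact (slice φ z).2

lemma subset_comodGen (b : M →ₗ[ℂ] M ⊗[ℂ] G) (s : Set M) : s ⊆ comodGen b s := by
  intro y hy
  simp only [comodGen, SetLike.mem_coe, Submodule.mem_sInf, Set.mem_ofPred_eq]
  exact fun W hW => hW.1 hy

lemma SpannedByCoreps.comodGen_le_ker (hs : H.SpannedByCoreps) (e : M →ₐ[ℂ] ℂ) {s : Set M}
    (h : s ⊆ LinearMap.ker (coorbit e H.β)) : comodGen H.β s ≤ LinearMap.ker (coorbit e H.β) := by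
  refine sInf_le ⟨h, fun w hw => ?_⟩
  have h := LinearMap.congr_fun (hs.map_coorbit_β e) w
  simp only [LinearMap.comp_apply, LinearMap.mem_ker.1 hw, map_zero] at h
  exact (Module.Flat.rTensor_exact G
    (LinearMap.exact_subtype_ker_map (coorbit e H.β)) _).1 h

end HopfPair

/-- The defining relations of `2 × 2` quantum matrices. -/
structure QRel (q : ℂ) {B : Type} [Ring B] [Algebra ℂ B] (y : Fin 2 → Fin 2 → B) : Prop where
  ab : y 0 0 * y 0 1 = q • (y 0 1 * y 0 0)
  cd : y 1 0 * y 1 1 = q • (y 1 1 * y 1 0)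
  ac : y 0 0 * y 1 0 = q • (y 1 0 * y 0 0)
  bd : y 0 1 * y 1 1 = q • (y 1 1 * y 0 1)
  bc : y 0 1 * y 1 0 = y 1 0 * y 0 1
  ad : y 0 0 * y 1 1 - y 1 1 * y 0 0 = (q - q⁻¹) • (y 0 1 * y 1 0)

/-- The quantum determinant of a `2 × 2` matrix. -/
def qdet₂ (q : ℂ) {B : Type} [Ring B] [Algebra ℂ B] (y : Fin 2 → Fin 2 → B) : B :=
  y 0 0 * y 1 1 - q • (y 0 1 * y 1 0)

namespace QRel

variable {q : ℂ} {B : Type} [Ring B] [Algebra ℂ B] {y : Fin 2 → Fin 2 → B}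

lemma map (h : QRel q y) {C : Type} [Ring C] [Algebra ℂ C] (f : B →ₐ[ℂ] C) :
    QRel q (fun i j => f (y i j)) where
  ab := by simp only [← map_mul, h.ab, map_smul]
  cd := by simp only [← map_mul, h.cd, map_smul]
  ac := by simp only [← map_mul, h.ac, map_smul]
  bd := by simp only [← map_mul, h.bd, map_smul]
  bc := by simp only [← map_mul, h.bc]
  ad := by simp only [← map_mul, ← map_sub, h.ad, map_smul]

lemma db (h : QRel q y) (hq : q ≠ 0) : y 1 1 * y 0 1 = q⁻¹ • (y 0 1 * y 1 1) := by
  rw [h.bd, inv_smul_smul₀ hq]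

lemma dc (h : QRel q y) (hq : q ≠ 0) : y 1 1 * y 1 0 = q⁻¹ • (y 1 0 * y 1 1) := by
  rw [h.cd, inv_smul_smul₀ hq]

lemma da (h : QRel q y) : y 1 1 * y 0 0 = y 0 0 * y 1 1 - (q - q⁻¹) • (y 0 1 * y 1 0) := by
  rw [← h.ad]; abel

/-- Rewriting rules bringing words into the order `x₀₁, x₁₀, x₀₀, x₁₁`. -/
lemma reorder (h : QRel q y) (hq : q ≠ 0) :
    (∀ z, y 0 0 * (y 0 1 * z) = q • (y 0 1 * (y 0 0 * z))) ∧
    (∀ z, y 0 0 * (y 1 0 * z) = q • (y 1 0 * (y 0 0 * z))) ∧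
    (∀ z, y 1 1 * (y 0 1 * z) = q⁻¹ • (y 0 1 * (y 1 1 * z))) ∧
    (∀ z, y 1 1 * (y 1 0 * z) = q⁻¹ • (y 1 0 * (y 1 1 * z))) ∧
    (∀ z, y 1 0 * (y 0 1 * z) = y 0 1 * (y 1 0 * z)) ∧
    (∀ z, y 1 1 * (y 0 0 * z) = y 0 0 * (y 1 1 * z) - (q - q⁻¹) • (y 0 1 * (y 1 0 * z))) := by
  refine ⟨fun z => ?_, fun z => ?_, fun z => ?_, fun z => ?_, fun z => ?_, fun z => ?_⟩
  · rw [← mul_assoc, h.ab]; simp [mul_assoc]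
  · rw [← mul_assoc, h.ac]; simp [mul_assoc]
  · rw [← mul_assoc, h.db hq]; simp [mul_assoc]
  · rw [← mul_assoc, h.dc hq]; simp [mul_assoc]
  · rw [← mul_assoc, ← h.bc]; simp [mul_assoc]
  · rw [← mul_assoc, h.da]; simp [mul_assoc, sub_mul]

lemma qdet_comm (h : QRel q y) (hq : q ≠ 0) (i j : Fin 2) : Commute (qdet₂ q y) (y i j) := by
  obtain ⟨h1, h2, h3, h4, h5, h6⟩ := h.reorder hq
  unfold Commute SemiconjBy qdet₂
  fin_cases i <;> fin_cases j <;>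
    (simp only [Fin.zero_eta, Fin.mk_one, sub_mul, mul_sub, smul_mul_assoc, mul_smul_comm,
      mul_assoc, h1, h2, h3, h5, h6, h.ac, h.db hq, h.dc hq, ← h.bc, h.da, smul_smul]
     match_scalars <;> field_simp <;> ring)

lemma pow_a_mul_c (h : QRel q y) (n : ℕ) :
    y 0 0 ^ n * y 1 0 = q ^ n • (y 1 0 * y 0 0 ^ n) := by
  induction n with
  | zero => simp
  | succ n ih =>
    rw [pow_succ', mul_assoc, ih, mul_smul_comm, ← mul_assoc, h.ac, smul_mul_assoc, smul_smul,
      mul_assoc, pow_succ]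

lemma a_mul_pow_c (h : QRel q y) (n : ℕ) :
    y 0 0 * y 1 0 ^ n = q ^ n • (y 1 0 ^ n * y 0 0) := by
  induction n with
  | zero => simp
  | succ n ih =>
    rw [pow_succ, ← mul_assoc, ih, smul_mul_assoc, mul_assoc, h.ac, mul_smul_comm, smul_smul,
      mul_assoc, pow_succ]

end QRel

/-- The quantum matrix algebra `M` and the quantum group `G` of `GL₂`. -/
structure QuantumGL2 (q : ℂ) (M G : Type) [Ring M] [Algebra ℂ M] [Ring G] [Algebra ℂ G]
    extends HopfPair M G where
  /-- The generators. -/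
  x : Fin 2 → Fin 2 → M
  /-- The inverse of the quantum determinant. -/
  dInv : G
  q_ne : q ≠ 0
  rel : QRel q x
  gen : Algebra.adjoin ℂ (Set.range fun p : Fin 2 × Fin 2 => x p.1 p.2) = ⊤
  free : ∀ (B : Type) [Ring B] [Algebra ℂ B] (y : Fin 2 → Fin 2 → B), QRel q y →
    ∃ φ : M →ₐ[ℂ] B, ∀ i j, φ (x i j) = y i j
  det_mul : ι (qdet₂ q x) * dInv = 1
  mul_det : dInv * ι (qdet₂ q x) = 1
  freeG : ∀ (B : Type) [Ring B] [Algebra ℂ B] (φ : M →ₐ[ℂ] B) (u : B),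
    φ (qdet₂ q x) * u = 1 → u * φ (qdet₂ q x) = 1 → ∃ ψ : G →ₐ[ℂ] B, ψ.comp ι = φ
  comul_x : ∀ i j, comulM (x i j) = ∑ k, x i k ⊗ₜ[ℂ] x k j
  counit_x : ∀ i j, counit (ι (x i j)) = if i = j then 1 else 0

namespace QuantumGL2

variable {q : ℂ} {M G : Type} [Ring M] [Algebra ℂ M] [Ring G] [Algebra ℂ G]
  (Q : QuantumGL2 q M G)

/-- The quantum determinant. -/
def det : M := qdet₂ q Q.x

/-- The first coinvariant. -/
def τ : M := (q ^ 2)⁻¹ • Q.x 0 0 + (q ^ 4)⁻¹ • Q.x 1 1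

lemma isCorep_x : Q.IsCorep Q.x := ⟨Q.comul_x, Q.counit_x⟩

lemma spannedByCoreps : Q.SpannedByCoreps := by
  intro p h0 hadd hsmul hX a
  have ha : a ∈ Submodule.span ℂ
      (Submonoid.closure (Set.range fun p : Fin 2 × Fin 2 => Q.x p.1 p.2) : Set M) := by
    rw [← Algebra.adjoin_eq_span, Q.gen]; trivial
  have key : ∀ m ∈ Submonoid.closure (Set.range fun p : Fin 2 × Fin 2 => Q.x p.1 p.2),
      ∃ (κ : Type) (_ : Fintype κ) (_ : DecidableEq κ) (X : κ → κ → M), Q.IsCorep X ∧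
        ∃ i j, X i j = m := by
    intro m hm
    induction hm using Submonoid.closure_induction with
    | mem m hm =>
      obtain ⟨⟨i, j⟩, rfl⟩ := hm
      exact ⟨_, _, _, Q.x, Q.isCorep_x, i, j, rfl⟩
    | one => exact ⟨_, _, _, _, HopfPair.IsCorep.one, (), (), rfl⟩
    | mul m m' _ _ h h' =>
      obtain ⟨κ, _, _, X, hX, i, j, rfl⟩ := h
      obtain ⟨κ', _, _, X', hX', i', j', rfl⟩ := h'
      exact ⟨_, _, _, _, hX.prod hX', (i, i'), (j, j'), rfl⟩
  induction ha using Submodule.span_induction with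
  | mem m hm =>
    obtain ⟨κ, _, _, X, hX', i, j, rfl⟩ := key m hm
    exact hX κ _ _ X hX' i j
  | zero => exact h0
  | add a b _ _ ha hb => exact hadd a b ha hb
  | smul c a _ ha => exact hsmul c a ha

lemma relG : QRel q (fun i j => Q.ι (Q.x i j)) := Q.rel.map Q.ι

lemma dInv_comm (i j : Fin 2) : Commute Q.dInv (Q.ι (Q.x i j)) := by
  have h : Commute (Q.ι Q.det) (Q.ι (Q.x i j)) := (Q.rel.qdet_comm Q.q_ne i j).map Q.ι
  have h1 : Q.ι Q.det * Q.dInv = 1 := Q.det_mul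
  have h2 : Q.dInv * Q.ι Q.det = 1 := Q.mul_det
  calc Q.dInv * Q.ι (Q.x i j) = Q.dInv * Q.ι (Q.x i j) * (Q.ι Q.det * Q.dInv) := by
        rw [h1, mul_one]
    _ = Q.dInv * (Q.ι Q.det * Q.ι (Q.x i j)) * Q.dInv := by rw [h.eq]; simp only [mul_assoc]
    _ = Q.ι (Q.x i j) * Q.dInv := by rw [← mul_assoc, h2, one_mul]

/-- Algebra maps out of `G` are given by invertible quantum matrices. -/
lemma exists_hom {B : Type} [Ring B] [Algebra ℂ B] {y : Fin 2 → Fin 2 → B} (hy : QRel q y) (u : B)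
    (h1 : qdet₂ q y * u = 1) (h2 : u * qdet₂ q y = 1) :
    ∃ ψ : G →ₐ[ℂ] B, (∀ i j, ψ (Q.ι (Q.x i j)) = y i j) ∧ ψ Q.dInv = u := by
  obtain ⟨φ, hφ⟩ := Q.free B y hy
  have hdet : φ (qdet₂ q Q.x) = qdet₂ q y := by simp [qdet₂, hφ]
  obtain ⟨ψ, hψ⟩ := Q.freeG B φ u (by rw [hdet, h1]) (by rw [hdet, h2])
  have hψ' : ∀ m, ψ (Q.ι m) = φ m := fun m => AlgHom.congr_fun hψ m
  refine ⟨ψ, fun i j => by rw [hψ', hφ], ?_⟩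
  have h3 := congrArg ψ Q.det_mul
  rw [map_mul, hψ', hdet, map_one] at h3
  calc ψ Q.dInv = u * qdet₂ q y * ψ Q.dInv := by rw [h2, one_mul]
    _ = u := by rw [mul_assoc, h3, mul_one]

/-- The antipode on generators. -/
def adj (Q : QuantumGL2 q M G) : Fin 2 → Fin 2 → G :=
  ![![Q.ι (Q.x 1 1) * Q.dInv, -q⁻¹ • (Q.ι (Q.x 0 1) * Q.dInv)],
    ![-q • (Q.ι (Q.x 1 0) * Q.dInv), Q.ι (Q.x 0 0) * Q.dInv]]

lemma x_mul_x_mul_dInv : Q.ι (Q.x 0 0) * (Q.ι (Q.x 1 1) * Q.dInv)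
    = 1 + q • (Q.ι (Q.x 0 1) * (Q.ι (Q.x 1 0) * Q.dInv)) := by
  have := Q.det_mul
  simp only [qdet₂, map_sub, map_mul, map_smul, sub_mul, smul_mul_assoc, mul_assoc] at this
  rw [← this]; abel

lemma S_x (i j : Fin 2) : Q.S (Q.x i j) = Q.adj i j := by
  have hq := Q.q_ne
  obtain ⟨h1, h2, h3, h4, h5, h6⟩ := Q.relG.reorder hq
  refine Q.isCorep_x.eq_map_S (AlgHom.id ℂ G) Q.adj (fun i j => ?_) i j
  fin_cases i <;> fin_cases j <;>
    simp only [adj, AlgHom.id_apply, Fin.sum_univ_two, Fin.zero_eta, Fin.mk_one,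
      Matrix.cons_val_zero, Matrix.cons_val_one, mul_smul_comm, h1, h4, h5, h6,
      Q.x_mul_x_mul_dInv, ↓reduceIte, zero_ne_one, one_ne_zero, mul_neg, neg_smul, smul_smul] <;>
    match_scalars <;> field_simp <;> ring

lemma isCorep_det : Q.IsCorep (fun _ _ : Unit => Q.det) where
  comul _ _ := by
    have hq := Q.q_ne
    have hr := Q.rel
    simp only [det, qdet₂, map_sub, map_smul, map_mul, Q.comul_x, Fin.sum_univ_two, mul_add,
      add_mul, Algebra.TensorProduct.tmul_mul_tmul, Finset.univ_unique, Finset.sum_singleton,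
      TensorProduct.tmul_sub, TensorProduct.sub_tmul, hr.ab, hr.ac, hr.dc hq, ← hr.bc,
      hr.da, TensorProduct.tmul_smul, ← TensorProduct.smul_tmul', smul_smul, smul_sub, smul_add]
    match_scalars <;> (try field_simp) <;> ring
  counit _ _ := by simp [det, qdet₂, Q.counit_x]

lemma β_det : Q.β Q.det = Q.det ⊗ₜ 1 := by
  have h := Q.isCorep_det.β_apply () ()
  simp only [Finset.univ_unique, Finset.sum_singleton] at h
  have hS := Q.isCorep_det.sum_S_mul () ()
  simp only [Finset.univ_unique, Finset.sum_singleton, if_true] at hS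
  rw [h, hS]

lemma β_τ : Q.β Q.τ = Q.τ ⊗ₜ 1 := by
  have hq := Q.q_ne
  have hc : ∀ i j, Q.dInv * Q.ι (Q.x i j) = Q.ι (Q.x i j) * Q.dInv :=
    fun i j => (Q.dInv_comm i j).eq
  obtain ⟨h1, h2, h3, h4, h5, h6⟩ := Q.relG.reorder hq
  have key : ∀ k l, (q ^ 2)⁻¹ • (Q.S (Q.x 0 k) * Q.ι (Q.x l 0))
      + (q ^ 4)⁻¹ • (Q.S (Q.x 1 k) * Q.ι (Q.x l 1))
      = if k = l then (if k = 0 then (q ^ 2)⁻¹ else (q ^ 4)⁻¹) • 1 else 0 := by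
    intro k l
    simp only [Q.S_x]
    fin_cases k <;> fin_cases l <;>
    simp only [adj, Fin.zero_eta, Fin.mk_one, Matrix.cons_val_zero, Matrix.cons_val_one,
      smul_mul_assoc, mul_assoc, hc, h1, h4, h5, h6, Q.x_mul_x_mul_dInv,
      ↓reduceIte, zero_ne_one, one_ne_zero, neg_mul, neg_smul, smul_neg] <;>
    match_scalars <;> field_simp <;> ring
  have hx : ∀ i j, Q.β (Q.x i j) = ∑ k, ∑ l, Q.x k l ⊗ₜ[ℂ] (Q.S (Q.x i k) * Q.ι (Q.x l j)) :=
    Q.isCorep_x.β_apply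
  have : Q.β Q.τ = ∑ k, ∑ l, Q.x k l ⊗ₜ[ℂ] ((q ^ 2)⁻¹ • (Q.S (Q.x 0 k) * Q.ι (Q.x l 0))
      + (q ^ 4)⁻¹ • (Q.S (Q.x 1 k) * Q.ι (Q.x l 1))) := by
    simp only [τ, map_add, map_smul, hx, TensorProduct.tmul_add, TensorProduct.tmul_smul,
      Finset.sum_add_distrib, Finset.smul_sum]
  rw [this]
  simp only [key]
  simp [Fin.sum_univ_two, τ, TensorProduct.add_tmul, TensorProduct.smul_tmul']

/-- The image of `x₁₀ ^ n` under the coorbit map, up to a scalar. -/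
def hw (n : ℕ) : G := Q.ι (Q.x 1 0) ^ n * Q.ι (Q.x 0 0) ^ n * Q.dInv ^ n

lemma coorbit_pow (e : M →ₐ[ℂ] ℂ) (h01 : e (Q.x 0 1) = 0) (h10 : e (Q.x 1 0) = 0) (n : ℕ) :
    coorbit e Q.β (Q.x 1 0 ^ n)
      = (∏ k ∈ Finset.range n, (-q * (e (Q.x 0 0) - q ^ (2 * k) * e (Q.x 1 1)))) • Q.hw n := by
  induction n with
  | zero =>
    have h := (HopfPair.IsCorep.one (H := Q.toHopfPair)).coorbit_apply e () ()
    have hS := (HopfPair.IsCorep.one (H := Q.toHopfPair)).sum_S_mul () ()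
    simp only [Finset.univ_unique, Finset.sum_singleton, if_true] at h hS
    simp at hS
    simp [h, hS, hw]
  | succ n ih =>
    rw [pow_succ, Q.spannedByCoreps.coorbit_mul e Q.isCorep_x, ih]
    have hr := Q.relG
    have hc : ∀ i j, Commute (Q.dInv ^ n) (Q.ι (Q.x i j)) := fun i j =>
      (Q.dInv_comm i j).pow_left n
    have hc' : ∀ i j, Commute Q.dInv (Q.ι (Q.x i j) ^ n) := fun i j =>
      (Q.dInv_comm i j).pow_right n
    have e1 : Q.ι (Q.x 1 0) * Q.dInv * (Q.hw n * Q.ι (Q.x 0 0)) = Q.hw (n + 1) := by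
      calc _ = Q.ι (Q.x 1 0) * (Q.dInv * Q.ι (Q.x 1 0) ^ n) * Q.ι (Q.x 0 0) ^ n
            * (Q.dInv ^ n * Q.ι (Q.x 0 0)) := by simp only [hw, mul_assoc]
        _ = Q.ι (Q.x 1 0) * Q.ι (Q.x 1 0) ^ n * (Q.dInv * Q.ι (Q.x 0 0) ^ n)
            * Q.ι (Q.x 0 0) * Q.dInv ^ n := by
          rw [(hc _ _).eq, (hc' _ _).eq]; simp only [mul_assoc]
        _ = Q.ι (Q.x 1 0) * Q.ι (Q.x 1 0) ^ n * Q.ι (Q.x 0 0) ^ n *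
            (Q.dInv * Q.ι (Q.x 0 0)) * Q.dInv ^ n := by
          rw [(hc' _ _).eq]; simp only [mul_assoc]
        _ = _ := by
          rw [(Q.dInv_comm _ _).eq, hw, pow_succ', pow_succ _ n, pow_succ' Q.dInv]
          simp only [mul_assoc]
    have e2 : Q.ι (Q.x 0 0) * Q.dInv * (Q.hw n * Q.ι (Q.x 1 0))
        = q ^ (2 * n + 1) • Q.hw (n + 1) := by
      calc _ = Q.ι (Q.x 0 0) * (Q.dInv * Q.ι (Q.x 1 0) ^ n) * Q.ι (Q.x 0 0) ^ n
            * (Q.dInv ^ n * Q.ι (Q.x 1 0)) := by simp only [hw, mul_assoc]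
        _ = (Q.ι (Q.x 0 0) * Q.ι (Q.x 1 0) ^ n) * (Q.dInv * Q.ι (Q.x 0 0) ^ n)
            * Q.ι (Q.x 1 0) * Q.dInv ^ n := by
          rw [(hc _ _).eq, (hc' _ _).eq]; simp only [mul_assoc]
        _ = q ^ n • (Q.ι (Q.x 1 0) ^ n * (Q.ι (Q.x 0 0) ^ (n + 1) *
            (Q.dInv * Q.ι (Q.x 1 0)) * Q.dInv ^ n)) := by
          rw [(hc' _ _).eq, hr.a_mul_pow_c, pow_succ']; simp only [mul_assoc, smul_mul_assoc]
        _ = _ := by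
          rw [(Q.dInv_comm _ _).eq, ← mul_assoc (_ ^ (n + 1)), hr.pow_a_mul_c, hw,
            pow_succ (Q.ι (Q.x 1 0)) n, pow_succ' Q.dInv,
            show q ^ (2 * n + 1) = q ^ n * q ^ (n + 1) by ring]
          simp only [mul_assoc, smul_mul_assoc, mul_smul_comm, smul_smul]
    simp only [Fin.sum_univ_two, Q.S_x, adj, Matrix.cons_val_zero, Matrix.cons_val_one,
      h01, h10, zero_smul, add_zero, zero_add, smul_mul_assoc, mul_smul_comm, e1, e2]
    rw [Finset.prod_range_succ]
    module

/-- Functionals separating the elements `hw n`. -/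
lemma exists_dual : ∃ f : ℕ → G →ₗ[ℂ] ℂ, ∀ n k, f n (Q.hw k) = if n = k then 1 else 0 := by
  have hq := Q.q_ne
  let A : Module.End ℂ (ℤ → ℂ) :=
    { toFun := fun f i => q ^ i * f i
      map_add' := fun f g => by ext i; simp [mul_add]
      map_smul' := fun c f => by ext i; simp [mul_left_comm] }
  let D : Module.End ℂ (ℤ → ℂ) :=
    { toFun := fun f i => q ^ (-i) * f i
      map_add' := fun f g => by ext i; simp [mul_add]
      map_smul' := fun c f => by ext i; simp [mul_left_comm] }
  let C : Module.End ℂ (ℤ → ℂ) :=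
    { toFun := fun f i => f (i - 1)
      map_add' := fun f g => by ext i; simp
      map_smul' := fun c f => by ext i; simp }
  have hA : ∀ f i, A f i = q ^ i * f i := fun _ _ => rfl
  have hD : ∀ f i, D f i = q ^ (-i) * f i := fun _ _ => rfl
  have hC : ∀ f i, C f i = f (i - 1) := fun _ _ => rfl
  let y : Fin 2 → Fin 2 → Module.End ℂ (ℤ → ℂ) := ![![A, 0], ![C, D]]
  have hAD : A * D = 1 := by
    refine LinearMap.ext fun f => funext fun i => ?_
    simp only [Module.End.mul_apply, hA, hD, Module.End.one_apply]
    rw [← mul_assoc, ← zpow_add₀ hq]; simp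
  have hDA : D * A = 1 := by
    refine LinearMap.ext fun f => funext fun i => ?_
    simp only [Module.End.mul_apply, hA, hD, Module.End.one_apply]
    rw [← mul_assoc, ← zpow_add₀ hq]; simp
  have hy : QRel q y := by
    refine ⟨by simp [y], ?_, ?_, by simp [y], by simp [y], by simp [y, hAD, hDA]⟩
    · refine LinearMap.ext fun f => funext fun i => ?_
      simp only [y, Matrix.cons_val_zero, Matrix.cons_val_one, Module.End.mul_apply, hC, hD,
        LinearMap.smul_apply, Pi.smul_apply, smul_eq_mul]
      rw [← mul_assoc, ← zpow_one_add₀ hq]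
      congr 2; ring
    · refine LinearMap.ext fun f => funext fun i => ?_
      simp only [y, Matrix.cons_val_zero, Matrix.cons_val_one, Module.End.mul_apply, hC, hA,
        LinearMap.smul_apply, Pi.smul_apply, smul_eq_mul]
      rw [← mul_assoc, ← zpow_one_add₀ hq]
      congr 2; ring
  have hdet : qdet₂ q y = 1 := by simp [qdet₂, y, hAD]
  obtain ⟨ψ, hψ, hψd⟩ := Q.exists_hom hy 1 (by simp [hdet]) (by simp [hdet])
  let δ : ℤ → ℤ → ℂ := fun k i => if i = k then 1 else 0
  refine ⟨fun n => LinearMap.proj (n : ℤ) ∘ₗ LinearMap.applyₗ (δ 0) ∘ₗ ψ.toLinearMap,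
    fun n k => ?_⟩
  have hA0 : ∀ k, (A ^ k) (δ 0) = δ 0 := by
    intro k
    induction k with
    | zero => simp
    | succ k ih =>
      rw [pow_succ', Module.End.mul_apply, ih]
      ext i
      by_cases hi : i = 0 <;> simp [hA, δ, hi]
  have hC0 : ∀ k : ℕ, (C ^ k) (δ 0) = δ k := by
    intro k
    induction k with
    | zero => simp
    | succ k ih =>
      rw [pow_succ', Module.End.mul_apply, ih]
      ext i
      simp [hC, δ, sub_eq_iff_eq_add]
  simp only [LinearMap.comp_apply, AlgHom.toLinearMap_apply, hw, map_mul, map_pow, hψ, hψd,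
    LinearMap.applyₗ_apply_apply, one_pow, mul_one, Module.End.mul_apply, LinearMap.proj_apply]
  simp [y, hA0, hC0, δ]

end QuantumGL2

namespace HopfPair

variable {M G : Type} [Ring M] [Algebra ℂ M] [Ring G] [Algebra ℂ G] (H : HopfPair M G)

/-- A matrix coefficient of a two-dimensional representation of `G`. -/
def entry (Θ : G →ₐ[ℂ] Matrix (Fin 2) (Fin 2) ℂ) (p s : Fin 2) : G →ₗ[ℂ] ℂ :=
  Matrix.entryLinearMap ℂ ℂ p s ∘ₗ Θ.toLinearMap

lemma entry_apply (Θ : G →ₐ[ℂ] Matrix (Fin 2) (Fin 2) ℂ) (p s : Fin 2) (g : G) :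
    entry Θ p s g = Θ g p s := rfl

lemma entry_mul (Θ : G →ₐ[ℂ] Matrix (Fin 2) (Fin 2) ℂ) (p s : Fin 2) (g h : G) :
    entry Θ p s (g * h) = ∑ t, entry Θ p t g * entry Θ t s h := by
  simp only [entry_apply, map_mul, Matrix.mul_apply]

lemma regOp_entry_mul (Θ : G →ₐ[ℂ] Matrix (Fin 2) (Fin 2) ℂ) (p s : Fin 2) (g h : G) :
    H.regOp (entry Θ p s) (g * h)
      = ∑ t, H.regOp (entry Θ p t) g * H.regOp (entry Θ t s) h := by
  simp only [regOp, LinearMap.comp_apply, AlgHom.toLinearMap_apply, map_mul]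
  induction H.comul g using TensorProduct.induction_on with
  | zero => simp
  | add u v hu hv => simp only [add_mul, map_add, hu, hv, Finset.sum_add_distrib]
  | tmul a b =>
    induction H.comul h using TensorProduct.induction_on with
    | zero => simp
    | add u v hu hv => simp only [mul_add, map_add, hu, hv, Finset.sum_add_distrib]
    | tmul c d =>
      simp only [Algebra.TensorProduct.tmul_mul_tmul, slice_tmul, entry_mul, Finset.sum_smul,
        smul_mul_smul_comm]

variable {H}

lemma SpannedByCoreps.adOp_entry_mul (hs : H.SpannedByCoreps) {κ : Type} [Fintype κ]
    [DecidableEq κ] {Y : κ → κ → M} (hY : H.IsCorep Y)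
    (Θ : G →ₐ[ℂ] Matrix (Fin 2) (Fin 2) ℂ) (p s : Fin 2) (a : M) (i j : κ) :
    H.adOp (entry Θ p s) (a * Y i j) = ∑ k, ∑ l, ∑ t, ∑ u,
      (entry Θ p t (H.S (Y i k)) * entry Θ u s (H.ι (Y l j))) •
        (H.adOp (entry Θ t u) a * Y k l) := by
  simp only [adOp, LinearMap.comp_apply, hs.β_mul hY]
  induction H.β a using TensorProduct.induction_on with
  | zero => simp
  | add u v hu hv => simp only [map_add, add_mul, smul_add, hu, hv, Finset.sum_add_distrib]
  | tmul b g =>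
    simp only [twist_tmul, map_sum, slice_tmul, entry_mul, Finset.mul_sum, Finset.sum_smul,
      smul_mul_assoc, smul_smul]
    refine Finset.sum_congr rfl fun k _ => Finset.sum_congr rfl fun l _ =>
      Finset.sum_congr rfl fun t _ => Finset.sum_congr rfl fun u _ => ?_
    congr 1
    ring

end HopfPair

namespace QuantumGL2

variable {q : ℂ} {M G : Type} [Ring M] [Algebra ℂ M] [Ring G] [Algebra ℂ G]
  (Q : QuantumGL2 q M G)

open HopfPair

lemma comul_dInv : Q.comul Q.dInv = Q.dInv ⊗ₜ Q.dInv := by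
  have h := Q.isCorep_det.comul_ι () ()
  simp only [Finset.univ_unique, Finset.sum_singleton] at h
  have h1 : Q.ι Q.det * Q.dInv = 1 := Q.det_mul
  have h2 : Q.dInv * Q.ι Q.det = 1 := Q.mul_det
  calc Q.comul Q.dInv
      = Q.comul Q.dInv * (Q.comul (Q.ι Q.det) * (Q.dInv ⊗ₜ Q.dInv)) := by
        rw [h, Algebra.TensorProduct.tmul_mul_tmul, h1, ← Algebra.TensorProduct.one_def, mul_one]
    _ = Q.dInv ⊗ₜ Q.dInv := by rw [← mul_assoc, ← map_mul, h2, map_one, one_mul]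

/-- A quantum matrix with entries in `2 × 2` matrices, acting by raising the weight. -/
def matE (q : ℂ) : Fin 2 → Fin 2 → Matrix (Fin 2) (Fin 2) ℂ :=
  ![![!![q, 0; 0, 1], !![0, 1; 0, 0]], ![0, !![1, 0; 0, q]]]

/-- A quantum matrix with entries in `2 × 2` matrices, acting by lowering the weight. -/
def matF (q : ℂ) : Fin 2 → Fin 2 → Matrix (Fin 2) (Fin 2) ℂ :=
  ![![!![1, 0; 0, q], 0], ![!![0, 0; 1, 0], !![q, 0; 0, 1]]]

lemma exists_repE : ∃ Θ : G →ₐ[ℂ] Matrix (Fin 2) (Fin 2) ℂ,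
    (∀ i j, Θ (Q.ι (Q.x i j)) = matE q i j) ∧ Θ Q.dInv = q⁻¹ • 1 := by
  have hq := Q.q_ne
  have hd : qdet₂ q (matE q) = q • 1 := by
    ext i j; fin_cases i <;> fin_cases j <;> simp [qdet₂, matE]
  refine Q.exists_hom ⟨?_, ?_, ?_, ?_, ?_, ?_⟩ _ (by simp [hd, hq]) (by simp [hd, hq]) <;>
    ext i j <;> fin_cases i <;> fin_cases j <;> simp [matE]

lemma exists_repF : ∃ Θ : G →ₐ[ℂ] Matrix (Fin 2) (Fin 2) ℂ,
    (∀ i j, Θ (Q.ι (Q.x i j)) = matF q i j) ∧ Θ Q.dInv = q⁻¹ • 1 := by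
  have hq := Q.q_ne
  have hd : qdet₂ q (matF q) = q • 1 := by
    ext i j; fin_cases i <;> fin_cases j <;> simp [qdet₂, matF]
  refine Q.exists_hom ⟨?_, ?_, ?_, ?_, ?_, ?_⟩ _ (by simp [hd, hq]) (by simp [hd, hq]) <;>
    ext i j <;> fin_cases i <;> fin_cases j <;> simp [matF]

/-- The representation extending `matE`. -/
def repE : G →ₐ[ℂ] Matrix (Fin 2) (Fin 2) ℂ := Q.exists_repE.choose

/-- The representation extending `matF`. -/
def repF : G →ₐ[ℂ] Matrix (Fin 2) (Fin 2) ℂ := Q.exists_repF.choose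

lemma repE_x (i j : Fin 2) : Q.repE (Q.ι (Q.x i j)) = matE q i j := Q.exists_repE.choose_spec.1 i j

lemma repE_dInv : Q.repE Q.dInv = q⁻¹ • 1 := Q.exists_repE.choose_spec.2

lemma repF_x (i j : Fin 2) : Q.repF (Q.ι (Q.x i j)) = matF q i j := Q.exists_repF.choose_spec.1 i j

lemma repF_dInv : Q.repF Q.dInv = q⁻¹ • 1 := Q.exists_repF.choose_spec.2

/-- The lowering functional. -/
def lowF : G →ₗ[ℂ] ℂ := entry Q.repE 0 1

/-- The raising functional. -/
def raiseF : G →ₗ[ℂ] ℂ := entry Q.repF 1 0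

/-- The lowering operator on `G`. -/
def lowG : G →ₗ[ℂ] G := Q.regOp Q.lowF

/-- The raising operator on `G`. -/
def raiseG : G →ₗ[ℂ] G := Q.regOp Q.raiseF

lemma regOp_dInv (φ : G →ₗ[ℂ] ℂ) : Q.regOp φ Q.dInv = φ Q.dInv • Q.dInv := by
  simp [regOp, Q.comul_dInv]

lemma regOp_x (φ : G →ₗ[ℂ] ℂ) (i j : Fin 2) :
    Q.regOp φ (Q.ι (Q.x i j)) = ∑ k, φ (Q.ι (Q.x k j)) • Q.ι (Q.x i k) := by
  simp [regOp, Q.isCorep_x.comul_ι]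

lemma regOp_one (φ : G →ₗ[ℂ] ℂ) : Q.regOp φ 1 = φ 1 • 1 := by
  simp [regOp, Algebra.TensorProduct.one_def]

lemma lowG_mul_dInv (g : G) : Q.lowG (g * Q.dInv) = q⁻¹ • (Q.lowG g * Q.dInv) := by
  simp [lowG, lowF, regOp_entry_mul, Fin.sum_univ_two, Q.regOp_dInv, entry_apply, repE_dInv]

lemma raiseG_mul_dInv (g : G) : Q.raiseG (g * Q.dInv) = q⁻¹ • (Q.raiseG g * Q.dInv) := by
  simp [raiseG, raiseF, regOp_entry_mul, Fin.sum_univ_two, Q.regOp_dInv, entry_apply, repF_dInv]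

lemma lowG_mul_dInv_pow (g : G) (n : ℕ) :
    Q.lowG (g * Q.dInv ^ n) = q⁻¹ ^ n • (Q.lowG g * Q.dInv ^ n) := by
  induction n with
  | zero => simp
  | succ n ih =>
    rw [pow_succ, ← mul_assoc, lowG_mul_dInv, ih, smul_mul_assoc, smul_smul, mul_assoc, pow_succ']

lemma raiseG_mul_dInv_pow (g : G) (n : ℕ) :
    Q.raiseG (g * Q.dInv ^ n) = q⁻¹ ^ n • (Q.raiseG g * Q.dInv ^ n) := by
  induction n with
  | zero => simp
  | succ n ih =>
    rw [pow_succ, ← mul_assoc, raiseG_mul_dInv, ih, smul_mul_assoc, smul_smul, mul_assoc, pow_succ']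

/-- The toral operator accompanying `lowG`. -/
def torE : G →ₗ[ℂ] G := Q.regOp (entry Q.repE 0 0)

/-- The toral operator accompanying `raiseG`. -/
def torF : G →ₗ[ℂ] G := Q.regOp (entry Q.repF 1 1)

lemma lowG_mul_x0 (g : G) (i : Fin 2) :
    Q.lowG (g * Q.ι (Q.x i 0)) = Q.lowG g * Q.ι (Q.x i 0) := by
  simp [lowG, lowF, regOp_entry_mul, Fin.sum_univ_two, regOp_x, entry_apply, repE_x, matE]

lemma lowG_mul_x1 (g : G) (i : Fin 2) : Q.lowG (g * Q.ι (Q.x i 1))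
    = Q.torE g * Q.ι (Q.x i 0) + q • (Q.lowG g * Q.ι (Q.x i 1)) := by
  simp [lowG, lowF, torE, regOp_entry_mul, Fin.sum_univ_two, regOp_x, entry_apply, repE_x, matE]

lemma raiseG_mul_x0 (g : G) (i : Fin 2) : Q.raiseG (g * Q.ι (Q.x i 0))
    = Q.raiseG g * Q.ι (Q.x i 0) + Q.torF g * Q.ι (Q.x i 1) := by
  simp [raiseG, raiseF, torF, regOp_entry_mul, Fin.sum_univ_two, regOp_x, entry_apply, repF_x, matF]

lemma raiseG_mul_x1 (g : G) (i : Fin 2) : Q.raiseG (g * Q.ι (Q.x i 1))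
    = q • (Q.raiseG g * Q.ι (Q.x i 1)) := by
  simp [raiseG, raiseF, regOp_entry_mul, Fin.sum_univ_two, regOp_x, entry_apply, repF_x, matF]

lemma torE_mul_x0 (g : G) (i : Fin 2) : Q.torE (g * Q.ι (Q.x i 0))
    = q • (Q.torE g * Q.ι (Q.x i 0)) := by
  simp [torE, regOp_entry_mul, Fin.sum_univ_two, regOp_x, entry_apply, repE_x, matE]

lemma torE_mul_x1 (g : G) (i : Fin 2) : Q.torE (g * Q.ι (Q.x i 1))
    = Q.torE g * Q.ι (Q.x i 1) := by
  simp [torE, regOp_entry_mul, Fin.sum_univ_two, regOp_x, entry_apply, repE_x, matE]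

lemma torF_mul_x0 (g : G) (i : Fin 2) : Q.torF (g * Q.ι (Q.x i 0))
    = q • (Q.torF g * Q.ι (Q.x i 0)) := by
  simp [torF, regOp_entry_mul, Fin.sum_univ_two, regOp_x, entry_apply, repF_x, matF]

lemma torF_mul_x1 (g : G) (i : Fin 2) : Q.torF (g * Q.ι (Q.x i 1))
    = Q.torF g * Q.ι (Q.x i 1) := by
  simp [torF, regOp_entry_mul, Fin.sum_univ_two, regOp_x, entry_apply, repF_x, matF]

/-- Words with `a` letters from the first column and `b` letters from the second. -/
inductive ColWord (Q : QuantumGL2 q M G) : ℕ → ℕ → G → Prop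
  | one : ColWord Q 0 0 1
  | mul0 (a b : ℕ) (g : G) (i : Fin 2) : ColWord Q a b g → ColWord Q (a + 1) b (g * Q.ι (Q.x i 0))
  | mul1 (a b : ℕ) (g : G) (i : Fin 2) : ColWord Q a b g → ColWord Q a (b + 1) (g * Q.ι (Q.x i 1))

/-- The `q`-integer `1 + q ^ 2 + ⋯ + q ^ (2 a - 2)`. -/
def qInt (q : ℂ) (a : ℕ) : ℂ := ∑ i ∈ Finset.range a, q ^ (2 * i)

lemma qInt_succ (a : ℕ) : qInt q (a + 1) = qInt q a + q ^ (2 * a) := Finset.sum_range_succ _ _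

lemma qInt_succ' (a : ℕ) : qInt q (a + 1) = q ^ 2 * qInt q a + 1 := by
  rw [qInt, Finset.sum_range_succ', qInt, Finset.mul_sum, mul_zero, pow_zero]
  congr 1
  exact Finset.sum_congr rfl fun i _ => by ring

lemma qInt_ne_zero (h : (∀ n : ℕ, 0 < n → q ^ n ≠ 1) ∨ q = 1) {a : ℕ} (ha : 0 < a) :
    qInt q a ≠ 0 := by
  rcases h with h | rfl
  · have h1 : (q ^ 2 - 1) * qInt q a = q ^ (2 * a) - 1 := by
      have := qInt_succ (q := q) a
      rw [qInt_succ'] at this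
      linear_combination this
    intro h0
    rw [h0, mul_zero] at h1
    exact h (2 * a) (by omega) (sub_eq_zero.1 h1.symm)
  · simpa [qInt] using ha.ne'

namespace ColWord

variable {Q} {a b : ℕ} {g : G}

lemma torE_eq (h : ColWord Q a b g) : Q.torE g = q ^ a • g := by
  induction h with
  | one => simp [torE, regOp_one, entry_apply]
  | mul0 a b g i _ ih => rw [torE_mul_x0, ih, smul_mul_assoc, smul_smul, pow_succ']
  | mul1 a b g i _ ih => rw [torE_mul_x1, ih, smul_mul_assoc]

lemma torF_eq (h : ColWord Q a b g) : Q.torF g = q ^ a • g := by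
  induction h with
  | one => simp [torF, regOp_one, entry_apply]
  | mul0 a b g i _ ih => rw [torF_mul_x0, ih, smul_mul_assoc, smul_smul, pow_succ']
  | mul1 a b g i _ ih => rw [torF_mul_x1, ih, smul_mul_assoc]

lemma torF_lowG (h : ColWord Q a b g) : Q.torF (Q.lowG g) = q ^ (a + 1) • Q.lowG g := by
  induction h with
  | one => simp [lowG, lowF, regOp_one, entry_apply]
  | mul0 a b g i _ ih =>
    rw [lowG_mul_x0, torF_mul_x0, ih, smul_mul_assoc, smul_smul, ← pow_succ']
  | mul1 a b g i h ih =>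
    simp only [lowG_mul_x1, map_add, map_smul, torF_mul_x0, torF_mul_x1, ih, h.torE_eq, h.torF_eq,
      smul_mul_assoc]
    module

lemma torE_raiseG (h : ColWord Q a b g) : q • Q.torE (Q.raiseG g) = q ^ a • Q.raiseG g := by
  induction h with
  | one => simp [raiseG, raiseF, regOp_one, entry_apply]
  | mul0 a b g i h ih =>
    simp only [raiseG_mul_x0, map_add, map_smul, torE_mul_x0, torE_mul_x1, h.torE_eq, h.torF_eq,
      smul_mul_assoc, ← smul_mul_assoc q (Q.torE (Q.raiseG g)), ih]
    module
  | mul1 a b g i h ih =>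
    rw [raiseG_mul_x1, map_smul, torE_mul_x1, ← smul_mul_assoc, ih, smul_mul_assoc, smul_comm]

lemma lowG_raiseG (h : ColWord Q a b g) :
    Q.lowG (Q.raiseG g) = Q.raiseG (Q.lowG g) + (qInt q a - qInt q b) • g := by
  induction h with
  | one => simp [raiseG, raiseF, lowG, lowF, regOp_one, entry_apply]
  | mul0 a b g i h ih =>
    simp only [raiseG_mul_x0, lowG_mul_x0, lowG_mul_x1, map_add, map_smul, h.torE_eq, h.torF_eq,
      h.torF_lowG, ih, smul_mul_assoc, add_mul, qInt_succ]
    module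
  | mul1 a b g i h ih =>
    have h1 : qInt q b - q ^ 2 * qInt q b = 1 - q ^ (2 * b) := by
      have := qInt_succ (q := q) b
      rw [qInt_succ'] at this
      linear_combination -this
    have h2 := qInt_succ (q := q) a
    rw [qInt_succ'] at h2
    have h3 : qInt q a - qInt q (b + 1) = q ^ 2 * (qInt q a - qInt q b) - q ^ (2 * a) := by
      rw [qInt_succ']; linear_combination -h2
    simp only [raiseG_mul_x0, raiseG_mul_x1, lowG_mul_x1, map_add, map_smul,
      h.torE_eq, h.torF_eq, ← smul_mul_assoc q (Q.torE (Q.raiseG g)), h.torE_raiseG, ih, smul_add,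
      smul_mul_assoc, add_mul, h3]
    module

end ColWord

/-- The span of the words with prescribed numbers of letters from the two columns. -/
def colSpan (a b : ℕ) : Submodule ℂ G := Submodule.span ℂ {g | ColWord Q a b g}

lemma mul0_mem_colSpan {a b : ℕ} {g : G} (h : g ∈ Q.colSpan a b) (i : Fin 2) :
    g * Q.ι (Q.x i 0) ∈ Q.colSpan (a + 1) b := by
  have : Q.colSpan a b ≤ (Q.colSpan (a + 1) b).comap (LinearMap.mulRight ℂ (Q.ι (Q.x i 0))) :=
    Submodule.span_le.2 fun g hg => Submodule.subset_span (ColWord.mul0 a b g i hg)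
  exact this h

lemma mul1_mem_colSpan {a b : ℕ} {g : G} (h : g ∈ Q.colSpan a b) (i : Fin 2) :
    g * Q.ι (Q.x i 1) ∈ Q.colSpan a (b + 1) := by
  have : Q.colSpan a b ≤ (Q.colSpan a (b + 1)).comap (LinearMap.mulRight ℂ (Q.ι (Q.x i 1))) :=
    Submodule.span_le.2 fun g hg => Submodule.subset_span (ColWord.mul1 a b g i hg)
  exact this h

lemma ColWord.raiseG_mem {Q : QuantumGL2 q M G} {a b : ℕ} {g : G} (h : ColWord Q a b g) :
    (a = 0 → Q.raiseG g = 0) ∧ ∀ a', a = a' + 1 → Q.raiseG g ∈ Q.colSpan a' (b + 1) := by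
  induction h with
  | one => simp [raiseG, raiseF, regOp_one, entry_apply]
  | mul0 a b g i h ih =>
    refine ⟨by simp, fun a' ha => ?_⟩
    obtain rfl : a = a' := by omega
    rw [raiseG_mul_x0, h.torF_eq, smul_mul_assoc]
    refine add_mem ?_ (Submodule.smul_mem _ _ (Submodule.subset_span (ColWord.mul1 a b g i h)))
    cases a with
    | zero => simp [ih.1 rfl]
    | succ a => exact Q.mul0_mem_colSpan (ih.2 a rfl) i
  | mul1 a b g i h ih =>
    rw [raiseG_mul_x1]
    refine ⟨fun ha => by simp [ih.1 ha], fun a' ha => ?_⟩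
    exact Submodule.smul_mem _ _ (Q.mul1_mem_colSpan (ih.2 a' ha) i)

lemma raiseG_mem_colSpan {a b : ℕ} {g : G} (h : g ∈ Q.colSpan (a + 1) b) :
    Q.raiseG g ∈ Q.colSpan a (b + 1) := by
  have : Q.colSpan (a + 1) b ≤ (Q.colSpan a (b + 1)).comap Q.raiseG :=
    Submodule.span_le.2 fun g hg => (ColWord.raiseG_mem hg).2 a rfl
  exact this h

lemma lowG_raiseG_of_mem {a b : ℕ} {g : G} (h : g ∈ Q.colSpan a b) :
    Q.lowG (Q.raiseG g) = Q.raiseG (Q.lowG g) + (qInt q a - qInt q b) • g := by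
  induction h using Submodule.span_induction with
  | mem g hg => exact ColWord.lowG_raiseG hg
  | zero => simp
  | add g g' _ _ h h' => simp only [map_add, h, h', smul_add]; abel
  | smul c g _ h => simp only [map_smul, h, smul_add, smul_comm c]

lemma raiseG_iterate_mem {N : ℕ} {g : G} (h : g ∈ Q.colSpan N 0) {r : ℕ} (hr : r ≤ N) :
    Q.raiseG^[r] g ∈ Q.colSpan (N - r) r := by
  induction r with
  | zero => simpa using h
  | succ r ih =>
    rw [Function.iterate_succ_apply']
    refine Q.raiseG_mem_colSpan ?_
    rw [show N - (r + 1) + 1 = N - r by omega]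
    exact ih (by omega)

lemma lowG_raiseG_iterate {N : ℕ} {g : G} (h : g ∈ Q.colSpan N 0) (hg : Q.lowG g = 0) {r : ℕ}
    (hr : r < N) : Q.lowG (Q.raiseG^[r + 1] g)
      = (qInt q (r + 1) * qInt q (N - r)) • Q.raiseG^[r] g := by
  induction r with
  | zero =>
    have := Q.lowG_raiseG_of_mem h
    simpa [hg, qInt] using this
  | succ r ih =>
    rw [Function.iterate_succ_apply', Q.lowG_raiseG_of_mem (Q.raiseG_iterate_mem h hr.le),
      ih (by omega), map_smul, ← Function.iterate_succ_apply' Q.raiseG, ← add_smul]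
    congr 1
    obtain ⟨M, rfl⟩ : ∃ M, N = r + 1 + M := ⟨N - (r + 1), by omega⟩
    rw [show r + 1 + M - r = M + 1 by omega, show r + 1 + M - (r + 1) = M by omega,
      qInt_succ (r + 1), qInt_succ M]
    have h1 : ∀ a, (q ^ 2 - 1) * qInt q a = q ^ (2 * a) - 1 := by
      intro a
      have := qInt_succ (q := q) a
      rw [qInt_succ'] at this
      linear_combination this
    linear_combination qInt q M * h1 (r + 1) - qInt q (r + 1) * h1 M

lemma exists_lowG_raiseG (hqru : (∀ n : ℕ, 0 < n → q ^ n ≠ 1) ∨ q = 1) {N : ℕ} {g : G}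
    (h : g ∈ Q.colSpan N 0) (hg : Q.lowG g = 0) {r : ℕ} (hr : r ≤ N) :
    ∃ c : ℂ, c ≠ 0 ∧ Q.lowG^[r] (Q.raiseG^[r] g) = c • g := by
  induction r with
  | zero => exact ⟨1, by simp⟩
  | succ r ih =>
    obtain ⟨c, hc, h'⟩ := ih (by omega)
    refine ⟨qInt q (r + 1) * qInt q (N - r) * c, ?_, ?_⟩
    · exact mul_ne_zero (mul_ne_zero (qInt_ne_zero hqru (by omega))
        (qInt_ne_zero hqru (by omega))) hc
    · rw [Function.iterate_succ_apply, Q.lowG_raiseG_iterate h hg (by omega), ← Module.End.coe_pow,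
        map_smul, Module.End.coe_pow, h', smul_smul]

lemma exists_lowG_raiseG_hw (hqru : (∀ n : ℕ, 0 < n → q ^ n ≠ 1) ∨ q = 1) {n r : ℕ}
    (hr : r ≤ 2 * n) : ∃ c : ℂ, c ≠ 0 ∧ Q.lowG^[r] (Q.raiseG^[r] (Q.hw n)) = c • Q.hw n := by
  have hword : ColWord Q (2 * n) 0 (Q.ι (Q.x 1 0) ^ n * Q.ι (Q.x 0 0) ^ n) := by
    have h1 : ∀ k, ColWord Q k 0 (Q.ι (Q.x 1 0) ^ k) := by
      intro k
      induction k with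
      | zero => simpa using ColWord.one
      | succ k ih => rw [pow_succ]; exact ih.mul0 _ _ _ _
    have h2 : ∀ k, ColWord Q (n + k) 0 (Q.ι (Q.x 1 0) ^ n * Q.ι (Q.x 0 0) ^ k) := by
      intro k
      induction k with
      | zero => simpa using h1 n
      | succ k ih => rw [pow_succ, ← mul_assoc]; exact ih.mul0 _ _ _ _
    rw [two_mul]
    exact h2 n
  have hlow : Q.lowG (Q.ι (Q.x 1 0) ^ n * Q.ι (Q.x 0 0) ^ n) = 0 := by
    have h0 : Q.lowG 1 = 0 := by simp [lowG, lowF, regOp_one, entry_apply]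
    have h1 : ∀ (g : G) i k, Q.lowG g = 0 → Q.lowG (g * Q.ι (Q.x i 0) ^ k) = 0 := by
      intro g i k hg
      induction k with
      | zero => simpa using hg
      | succ k ih => rw [pow_succ, ← mul_assoc, lowG_mul_x0, ih, zero_mul]
    exact h1 _ _ _ (by simpa using h1 1 1 n h0)
  obtain ⟨c, hc, h⟩ := Q.exists_lowG_raiseG hqru (Submodule.subset_span hword) hlow hr
  refine ⟨(q⁻¹ ^ n) ^ r * (q⁻¹ ^ n) ^ r * c, ?_, ?_⟩
  · exact mul_ne_zero (by simp [Q.q_ne]) hc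
  · have hR : ∀ g r, Q.raiseG^[r] (g * Q.dInv ^ n) = (q⁻¹ ^ n) ^ r • (Q.raiseG^[r] g * Q.dInv ^ n) := by
      intro g r
      induction r with
      | zero => simp
      | succ r ih =>
        rw [Function.iterate_succ_apply', ih, map_smul, raiseG_mul_dInv_pow, smul_smul, ← pow_succ,
          Function.iterate_succ_apply']
    have hL : ∀ g r, Q.lowG^[r] (g * Q.dInv ^ n) = (q⁻¹ ^ n) ^ r • (Q.lowG^[r] g * Q.dInv ^ n) := by
      intro g r
      induction r with
      | zero => simp
      | succ r ih =>
        rw [Function.iterate_succ_apply', ih, map_smul, lowG_mul_dInv_pow, smul_smul, ← pow_succ,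
          Function.iterate_succ_apply']
    rw [hw, hR, ← Module.End.coe_pow Q.lowG, map_smul, Module.End.coe_pow, hL, h, smul_mul_assoc,
      smul_smul, smul_smul]

end QuantumGL2

namespace QuantumGL2

variable {q : ℂ} {M G : Type} [Ring M] [Algebra ℂ M] [Ring G] [Algebra ℂ G]
  (Q : QuantumGL2 q M G)

open HopfPair

/-- The lowering operator on `M`. -/
def low : M →ₗ[ℂ] M := Q.adOp Q.lowF

/-- The raising operator on `M`. -/
def raise : M →ₗ[ℂ] M := Q.adOp Q.raiseF

/-- Words of length `n` and weight `r`, the letter `x i j` having weight `1 + j - i`. -/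
inductive Word (Q : QuantumGL2 q M G) : ℤ → ℤ → M → Prop
  | one : Word Q 0 0 1
  | mul_x {n r n' r' : ℤ} {a : M} (i j : Fin 2) : Word Q n r a → n' = n + 1 →
      r' = r + 1 + (j : ℕ) - (i : ℕ) → Word Q n' r' (a * Q.x i j)

/-- The component of `M` of length `n` and weight `r`. -/
def piece (n r : ℤ) : Submodule ℂ M := Submodule.span ℂ {a | Word Q n r a}

variable {Q}

lemma Word.mul {n r n' r' : ℤ} {a b : M} (ha : Word Q n r a) (hb : Word Q n' r' b) :
    Word Q (n + n') (r + r') (a * b) := by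
  induction hb with
  | one => simpa using ha
  | mul_x i j _ hn hr ih => rw [← mul_assoc]; exact ih.mul_x i j (by omega) (by omega)

lemma Word.bounds {n r : ℤ} {a : M} (h : Word Q n r a) : 0 ≤ n ∧ 0 ≤ r ∧ r ≤ 2 * n := by
  induction h with
  | one => simp
  | mul_x i j _ hn hr ih => omega

lemma Word.pow {n r : ℤ} {a : M} (ha : Word Q n r a) (k : ℕ) : Word Q (k * n) (k * r) (a ^ k) := by
  induction k with
  | zero => simpa using Word.one
  | succ k ih =>
    rw [pow_succ]
    have := ih.mul ha
    push_cast
    rwa [add_mul, add_mul, one_mul, one_mul]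

lemma Word.x (i j : Fin 2) : Word Q 1 (1 + (j : ℕ) - (i : ℕ)) (Q.x i j) := by
  simpa using Word.one.mul_x (Q := Q) i j rfl rfl

lemma Word.eq_pow {n r : ℤ} {a : M} (h : Word Q n r a) (hr : r = 0) :
    ∃ k : ℕ, n = k ∧ a = Q.x 1 0 ^ k := by
  induction h with
  | one => exact ⟨0, by simp⟩
  | @mul_x n r n' r' a i j h hn hr' ih =>
    have hb := h.bounds
    have hi : i = 1 := by
      by_contra hi
      have : (i : ℕ) ≠ 1 := fun h => hi (Fin.ext h)
      omega
    have hj : j = 0 := by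
      by_contra hj
      have : (j : ℕ) ≠ 0 := fun h => hj (Fin.ext h)
      omega
    subst hi hj
    obtain ⟨k, hk, rfl⟩ := ih (by simp at hr'; omega)
    exact ⟨k + 1, by push_cast; omega, (pow_succ _ _).symm⟩

variable (Q)

lemma piece_eq_bot {n r : ℤ} (h : n < 0 ∨ r < 0 ∨ 2 * n < r) : Q.piece n r = ⊥ := by
  rw [piece, Submodule.span_eq_bot]
  intro a ha
  have := Word.bounds ha
  omega

lemma mem_piece_zero {n : ℕ} {a : M} (h : a ∈ Q.piece n 0) : ∃ c : ℂ, a = c • Q.x 1 0 ^ n := by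
  have : Q.piece n 0 ≤ Submodule.span ℂ {Q.x 1 0 ^ n} := by
    refine Submodule.span_le.2 fun a ha => ?_
    obtain ⟨k, hk, rfl⟩ := Word.eq_pow ha rfl
    obtain rfl : n = k := by exact_mod_cast hk
    exact Submodule.mem_span_singleton_self _
  obtain ⟨c, hc⟩ := Submodule.mem_span_singleton.1 (this h)
  exact ⟨c, hc.symm⟩

lemma mul_x_mem_piece {n r n' r' : ℤ} {a : M} (h : a ∈ Q.piece n r) (i j : Fin 2)
    (hn : n' = n + 1) (hr : r' = r + 1 + (j : ℕ) - (i : ℕ)) : a * Q.x i j ∈ Q.piece n' r' := by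
  have : Q.piece n r ≤ (Q.piece n' r').comap (LinearMap.mulRight ℂ (Q.x i j)) :=
    Submodule.span_le.2 fun g hg => Submodule.subset_span (Word.mul_x i j hg hn hr)
  exact this h

/-- A representation whose matrix coefficients have compatible weights. -/
def Graded (Θ : G →ₐ[ℂ] Matrix (Fin 2) (Fin 2) ℂ) : Prop :=
  ∀ i j p s : Fin 2, ((s : ℕ) : ℤ) - (p : ℕ) ≠ (j : ℕ) - (i : ℕ) →
    entry Θ p s (Q.ι (Q.x i j)) = 0 ∧ entry Θ p s (Q.S (Q.x i j)) = 0

lemma graded_repE : Q.Graded Q.repE := by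
  intro i j p s h
  rw [S_x]
  fin_cases i <;> fin_cases j <;> fin_cases p <;> fin_cases s <;>
    first
    | (exfalso; simp at h; done)
    | simp [entry_apply, adj, repE_x, repE_dInv, matE]

lemma graded_repF : Q.Graded Q.repF := by
  intro i j p s h
  rw [S_x]
  fin_cases i <;> fin_cases j <;> fin_cases p <;> fin_cases s <;>
    first
    | (exfalso; simp at h; done)
    | simp [entry_apply, adj, repF_x, repF_dInv, matF]

lemma adOp_one (φ : G →ₗ[ℂ] ℂ) : Q.adOp φ 1 = φ 1 • 1 := by
  have h := (IsCorep.one (H := Q.toHopfPair)).β_apply () ()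
  have hS := (IsCorep.one (H := Q.toHopfPair)).sum_S_mul () ()
  simp only [Finset.univ_unique, Finset.sum_singleton, if_true, map_one, mul_one] at h hS
  rw [adOp, LinearMap.comp_apply, h, slice_tmul, hS]

lemma adOp_entry_mem {Θ : G →ₐ[ℂ] Matrix (Fin 2) (Fin 2) ℂ} (hΘ : Q.Graded Θ) {n r r' : ℤ}
    {a : M} (h : a ∈ Q.piece n r) (p s : Fin 2) (hr : r' = r + (p : ℕ) - (s : ℕ)) :
    Q.adOp (entry Θ p s) a ∈ Q.piece n r' := by
  have key : ∀ {n r a}, Word Q n r a → ∀ (p s : Fin 2) (r' : ℤ), r' = r + (p : ℕ) - (s : ℕ) →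
      Q.adOp (entry Θ p s) a ∈ Q.piece n r' := by
    intro n r a h
    induction h with
    | one =>
      intro p s r' hr
      rw [adOp_one, entry_apply, map_one]
      by_cases hps : p = s
      · subst hps
        obtain rfl : r' = 0 := by omega
        exact Submodule.smul_mem _ _ (Submodule.subset_span Word.one)
      · simp [Matrix.one_apply_ne hps]
    | mul_x i j h hn hr ih =>
      intro p s r' hr'
      rw [Q.spannedByCoreps.adOp_entry_mul Q.isCorep_x]
      refine sum_mem fun k _ => sum_mem fun l _ => sum_mem fun t _ => sum_mem fun u _ => ?_
      by_cases h1 : ((t : ℕ) : ℤ) - (p : ℕ) = (k : ℕ) - (i : ℕ)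
      · by_cases h2 : ((s : ℕ) : ℤ) - (u : ℕ) = (j : ℕ) - (l : ℕ)
        · exact Submodule.smul_mem _ _
            (Q.mul_x_mem_piece (ih t u _ rfl) k l hn (by omega))
        · simp [(hΘ l j u s h2).1]
      · simp [(hΘ i k p t h1).2]
  have : Q.piece n r ≤ (Q.piece n r').comap (Q.adOp (entry Θ p s)) :=
    Submodule.span_le.2 fun g hg => key hg p s r' hr
  exact this h

lemma low_mem {n r : ℤ} {a : M} (h : a ∈ Q.piece n r) : Q.low a ∈ Q.piece n (r - 1) :=
  Q.adOp_entry_mem Q.graded_repE h 0 1 (by simp)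

lemma raise_mem {n r : ℤ} {a : M} (h : a ∈ Q.piece n r) : Q.raise a ∈ Q.piece n (r + 1) :=
  Q.adOp_entry_mem Q.graded_repF h 1 0 (by simp)

lemma low_iterate_mem {n r : ℤ} {a : M} (h : a ∈ Q.piece n r) (k : ℕ) :
    Q.low^[k] a ∈ Q.piece n (r - k) := by
  induction k with
  | zero => simpa using h
  | succ k ih =>
    rw [Function.iterate_succ_apply']
    convert Q.low_mem ih using 1
    push_cast; ring_nf

lemma raise_iterate_mem {n r : ℤ} {a : M} (h : a ∈ Q.piece n r) (k : ℕ) :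
    Q.raise^[k] a ∈ Q.piece n (r + k) := by
  induction k with
  | zero => simpa using h
  | succ k ih =>
    rw [Function.iterate_succ_apply']
    convert Q.raise_mem ih using 1
    push_cast; ring_nf

/-- The vectors obtained from `x₁₀ ^ n` by raising `r` times. -/
def vec (n r : ℕ) : M := Q.raise^[r] (Q.x 1 0 ^ n)

lemma vec_mem (n r : ℕ) : Q.vec n r ∈ Q.piece n r := by
  have h : Word Q n 0 (Q.x 1 0 ^ n) := by simpa using (Word.x (Q := Q) 1 0).pow n
  simpa [vec] using Q.raise_iterate_mem (Submodule.subset_span h) r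

lemma vec_eq_zero {n r : ℕ} (h : 2 * n < r) : Q.vec n r = 0 := by
  have := Q.vec_mem n r
  rw [Q.piece_eq_bot (by omega)] at this
  simpa using this

lemma low_iterate_vec {n r k : ℕ} (h : r < k) : Q.low^[k] (Q.vec n r) = 0 := by
  have := Q.low_iterate_mem (Q.vec_mem n r) k
  rw [Q.piece_eq_bot (by omega)] at this
  simpa using this

lemma coorbit_low (e : M →ₐ[ℂ] ℂ) (a : M) (k : ℕ) :
    coorbit e Q.β (Q.low^[k] a) = Q.lowG^[k] (coorbit e Q.β a) := by
  induction k generalizing a with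
  | zero => rfl
  | succ k ih => rw [Function.iterate_succ_apply, ih, Function.iterate_succ_apply, low, lowG,
      Q.spannedByCoreps.coorbit_adOp]

lemma coorbit_raise (e : M →ₐ[ℂ] ℂ) (a : M) (k : ℕ) :
    coorbit e Q.β (Q.raise^[k] a) = Q.raiseG^[k] (coorbit e Q.β a) := by
  induction k generalizing a with
  | zero => rfl
  | succ k ih => rw [Function.iterate_succ_apply, ih, Function.iterate_succ_apply, raise, raiseG,
      Q.spannedByCoreps.coorbit_adOp]

lemma hw_ne_zero (n : ℕ) : Q.hw n ≠ 0 := by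
  obtain ⟨f, hf⟩ := Q.exists_dual
  intro h
  simpa [h] using hf n n

/-- A point at which the coorbit map does not vanish on the powers of `x₁₀`. -/
lemma exists_coorbit_pow : ∃ e : M →ₐ[ℂ] ℂ, ∀ n, ∃ c : ℂ, c ≠ 0 ∧
    coorbit e Q.β (Q.x 1 0 ^ n) = c • Q.hw n := by
  have hy : QRel q (![![1, 0], ![0, 0]] : Fin 2 → Fin 2 → ℂ) := by constructor <;> simp
  obtain ⟨e, he⟩ := Q.free ℂ _ hy
  refine ⟨e, fun n => ⟨_, ?_, Q.coorbit_pow e (by simp [he]) (by simp [he]) n⟩⟩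
  simp [he, Q.q_ne]

lemma pow_ne_zero' (n : ℕ) : Q.x 1 0 ^ n ≠ 0 := by
  obtain ⟨e, he⟩ := Q.exists_coorbit_pow
  obtain ⟨c, hc, h⟩ := he n
  intro h0
  rw [h0, map_zero] at h
  exact smul_ne_zero hc (Q.hw_ne_zero n) h.symm

lemma exists_low_vec (hqru : (∀ n : ℕ, 0 < n → q ^ n ≠ 1) ∨ q = 1) {n r : ℕ} (hr : r ≤ 2 * n) :
    ∃ c : ℂ, c ≠ 0 ∧ Q.low^[r] (Q.vec n r) = c • Q.x 1 0 ^ n := by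
  obtain ⟨e, he⟩ := Q.exists_coorbit_pow
  obtain ⟨d, hd, h⟩ := he n
  obtain ⟨c, hc, h'⟩ := Q.exists_lowG_raiseG_hw hqru hr
  obtain ⟨c', hc'⟩ := Q.mem_piece_zero (a := Q.low^[r] (Q.vec n r))
    (by simpa using Q.low_iterate_mem (Q.vec_mem n r) r)
  have h1 := Q.coorbit_low e (Q.vec n r) r
  rw [vec, coorbit_raise, h, ← Module.End.coe_pow Q.raiseG, map_smul, Module.End.coe_pow,
    ← Module.End.coe_pow Q.lowG, map_smul, Module.End.coe_pow, h'] at h1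
  rw [← vec, hc', map_smul, h, smul_comm] at h1
  have h2 := smul_left_injective ℂ (Q.hw_ne_zero n) (smul_right_injective G hd h1)
  exact ⟨c, hc, by rw [hc', h2]⟩

end QuantumGL2

namespace QuantumGL2

variable {q : ℂ} {M G : Type} [Ring M] [Algebra ℂ M] [Ring G] [Algebra ℂ G]
  (Q : QuantumGL2 q M G)

/-- Elements divisible on the left by the coinvariants, modulo lower pieces. -/
def coinvSpan (n r : ℤ) : Submodule ℂ M :=
  (Q.piece (n - 1) (r - 1)).map (LinearMap.mulLeft ℂ Q.τ)
    ⊔ (Q.piece (n - 2) (r - 2)).map (LinearMap.mulLeft ℂ Q.det)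

lemma τ_mul_mem {n r n' r' : ℤ} {a : M} (h : a ∈ Q.piece n r) (hn : n' = n + 1)
    (hr : r' = r + 1) : Q.τ * a ∈ Q.coinvSpan n' r' := by
  subst hn hr
  refine Submodule.mem_sup_left ⟨a, ?_, rfl⟩
  simpa using h

lemma det_mul_mem {n r n' r' : ℤ} {a : M} (h : a ∈ Q.piece n r) (hn : n' = n + 2)
    (hr : r' = r + 2) : Q.det * a ∈ Q.coinvSpan n' r' := by
  subst hn hr
  refine Submodule.mem_sup_right ⟨a, ?_, rfl⟩
  simpa using h

/-- The monomials `u ^ k * x₁₁ ^ l` with `u` an off-diagonal generator. -/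
def normalSet (n r : ℤ) : Set M :=
  {a | ∃ (i j : Fin 2) (k l : ℕ), i ≠ j ∧ n = k + l ∧ r = k * (1 + (j : ℕ) - (i : ℕ)) + l ∧
    a = Q.x i j ^ k * Q.x 1 1 ^ l}

lemma normalSet_subsingleton (n r : ℤ) : (Q.normalSet n r).Subsingleton := by
  rintro _ ⟨i, j, k, l, hij, hn, hr, rfl⟩ _ ⟨i', j', k', l', hij', hn', hr', rfl⟩
  fin_cases i <;> fin_cases j <;> fin_cases i' <;> fin_cases j' <;> simp at hij hij' hr hr' ⊢
  · obtain ⟨rfl, rfl⟩ : k = k' ∧ l = l' := by omega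
    rfl
  · obtain ⟨rfl, rfl, rfl⟩ : k = 0 ∧ k' = 0 ∧ l = l' := by omega
    simp
  · obtain ⟨rfl, rfl, rfl⟩ : k = 0 ∧ k' = 0 ∧ l = l' := by omega
    simp
  · obtain ⟨rfl, rfl⟩ : k = k' ∧ l = l' := by omega
    rfl

variable {Q}

lemma normalSet_word {n r : ℤ} {a : M} (h : a ∈ Q.normalSet n r) : Word Q n r a := by
  obtain ⟨i, j, k, l, _, rfl, rfl, rfl⟩ := h
  have := ((Word.x (Q := Q) i j).pow k).mul ((Word.x (Q := Q) 1 1).pow l)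
  simpa using this

variable (Q)

/-- The span of normal monomials and multiples of coinvariants. -/
def goodSpan (n r : ℤ) : Submodule ℂ M := Submodule.span ℂ (Q.normalSet n r) ⊔ Q.coinvSpan n r

lemma d_mul_off {i j : Fin 2} (hij : i ≠ j) : Q.x 1 1 * Q.x i j = q⁻¹ • (Q.x i j * Q.x 1 1) := by
  fin_cases i <;> fin_cases j <;> simp at hij ⊢
  · exact Q.rel.db Q.q_ne
  · exact Q.rel.dc Q.q_ne

lemma d_pow_mul_off {i j : Fin 2} (hij : i ≠ j) (l : ℕ) :
    Q.x 1 1 ^ l * Q.x i j = q⁻¹ ^ l • (Q.x i j * Q.x 1 1 ^ l) := by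
  induction l with
  | zero => simp
  | succ l ih => rw [pow_succ', mul_assoc, ih, mul_smul_comm, ← mul_assoc, Q.d_mul_off hij,
      smul_mul_assoc, smul_smul, mul_assoc, pow_succ]

lemma d_mul_off_pow {i j : Fin 2} (hij : i ≠ j) (k : ℕ) :
    Q.x 1 1 * Q.x i j ^ k = q⁻¹ ^ k • (Q.x i j ^ k * Q.x 1 1) := by
  induction k with
  | zero => simp
  | succ k ih => rw [pow_succ, ← mul_assoc, ih, smul_mul_assoc, mul_assoc, Q.d_mul_off hij,
      mul_smul_comm, smul_smul, ← mul_assoc, pow_succ]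

lemma off_pow_mul_a {i j : Fin 2} (hij : i ≠ j) (k : ℕ) :
    Q.x i j ^ k * Q.x 0 0 = q⁻¹ ^ k • (Q.x 0 0 * Q.x i j ^ k) := by
  have h : Q.x i j * Q.x 0 0 = q⁻¹ • (Q.x 0 0 * Q.x i j) := by
    rw [eq_inv_smul_iff₀ Q.q_ne]
    fin_cases i <;> fin_cases j <;> simp at hij ⊢
    · exact Q.rel.ab.symm
    · exact Q.rel.ac.symm
  induction k with
  | zero => simp
  | succ k ih => rw [pow_succ', mul_assoc, ih, mul_smul_comm, ← mul_assoc, h,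
      smul_mul_assoc, smul_smul, mul_assoc, pow_succ]

lemma exists_d_pow_mul_a (l : ℕ) : ∃ c : ℂ, Q.x 1 1 ^ (l + 1) * Q.x 0 0
    = Q.x 0 0 * Q.x 1 1 ^ (l + 1) + c • (Q.x 0 1 * Q.x 1 0 * Q.x 1 1 ^ l) := by
  have h := Q.rel.da
  induction l with
  | zero => exact ⟨-(q - q⁻¹), by
    rw [zero_add, pow_one, pow_zero, mul_one, h, neg_smul, sub_eq_add_neg]⟩
  | succ l ih =>
    obtain ⟨c, hc⟩ := ih
    refine ⟨-(q - q⁻¹) + q⁻¹ * q⁻¹ * c, ?_⟩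
    have h1 : Q.x 1 1 * (Q.x 0 1 * Q.x 1 0 * Q.x 1 1 ^ l)
        = (q⁻¹ * q⁻¹) • (Q.x 0 1 * Q.x 1 0 * Q.x 1 1 ^ (l + 1)) := by
      rw [← mul_assoc, ← mul_assoc, Q.rel.db Q.q_ne, smul_mul_assoc, mul_assoc (Q.x 0 1),
        Q.rel.dc Q.q_ne, mul_smul_comm, smul_smul, smul_mul_assoc, pow_succ']
      simp only [mul_assoc]
    rw [pow_succ' _ (l + 1), mul_assoc, hc, mul_add, mul_smul_comm, h1, ← mul_assoc, h, sub_mul,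
      smul_mul_assoc, mul_assoc (Q.x 0 0), ← pow_succ']
    module

variable {Q}

lemma d_mul_normal {n r n' r' : ℤ} {a : M} (h : a ∈ Q.normalSet n r) (hn : n' = n + 1)
    (hr : r' = r + 1) : ∃ c : ℂ, ∃ b ∈ Q.normalSet n' r', Q.x 1 1 * a = c • b := by
  obtain ⟨i, j, k, l, hij, rfl, rfl, rfl⟩ := h
  refine ⟨q⁻¹ ^ k, _, ⟨i, j, k, l + 1, hij, by push_cast; omega, by push_cast; omega, rfl⟩, ?_⟩
  rw [← mul_assoc, Q.d_mul_off_pow hij, smul_mul_assoc, mul_assoc, pow_succ']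

lemma a_mul_normal {n r n' r' : ℤ} {a : M} (h : a ∈ Q.normalSet n r) (hn : n' = n + 1)
    (hr : r' = r + 1) : Q.x 0 0 * a ∈ Q.goodSpan n' r' := by
  have hq := Q.q_ne
  obtain ⟨c, b, hb, hab⟩ := d_mul_normal h hn hr
  have : Q.x 0 0 * a = q ^ 2 • (Q.τ * a) - (q ^ 2)⁻¹ • c • b := by
    rw [← hab, τ, add_mul, smul_mul_assoc, smul_mul_assoc]
    match_scalars <;> field_simp
    ring
  rw [this]
  exact sub_mem (Submodule.smul_mem _ _ (Submodule.mem_sup_right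
      (Q.τ_mul_mem (Submodule.subset_span (normalSet_word h)) hn hr)))
    (Submodule.smul_mem _ _ (Submodule.smul_mem _ _
      (Submodule.mem_sup_left (Submodule.subset_span hb))))

lemma bc_mul_normal {n r n' r' : ℤ} {a : M} (h : a ∈ Q.normalSet n r) (hn : n' = n + 2)
    (hr : r' = r + 2) : Q.x 0 1 * Q.x 1 0 * a ∈ Q.goodSpan n' r' := by
  have hq := Q.q_ne
  obtain ⟨c, b, hb, hab⟩ := d_mul_normal h rfl rfl
  have : Q.x 0 1 * Q.x 1 0 * a = q⁻¹ • (c • (Q.x 0 0 * b) - Q.det * a) := by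
    rw [det, qdet₂, sub_mul, mul_assoc (Q.x 0 0), hab, mul_smul_comm, sub_sub_cancel,
      smul_mul_assoc, inv_smul_smul₀ hq]
  rw [this]
  exact Submodule.smul_mem _ _ (sub_mem (Submodule.smul_mem _ _
    (a_mul_normal hb (by omega) (by omega))) (Submodule.mem_sup_right
      (Q.det_mul_mem (Submodule.subset_span (normalSet_word h)) hn hr)))

lemma normal_mul_x {n r n' r' : ℤ} {a : M} (h : a ∈ Q.normalSet n r) (i j : Fin 2)
    (hn : n' = n + 1) (hr : r' = r + 1 + (j : ℕ) - (i : ℕ)) : a * Q.x i j ∈ Q.goodSpan n' r' := by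
  obtain ⟨s, t, k, l, hst, rfl, rfl, rfl⟩ := h
  have hbc : ∀ s t, s ≠ t → Q.x s t * Q.x t s = Q.x 0 1 * Q.x 1 0 := by
    intro s t hst
    fin_cases s <;> fin_cases t <;> simp at hst ⊢
    exact Q.rel.bc.symm
  by_cases hij : i = j
  · subst hij
    obtain rfl | rfl : i = 0 ∨ i = 1 := by fin_cases i <;> simp
    · rcases l with _ | l
      · rw [pow_zero, mul_one, Q.off_pow_mul_a hst]
        have hmem : Q.x s t ^ k ∈ Q.normalSet k (k * (1 + (t : ℕ) - (s : ℕ))) :=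
          ⟨s, t, k, 0, hst, by simp, by simp, by simp⟩
        exact Submodule.smul_mem _ _ (a_mul_normal hmem (by simpa using hn) (by simpa using hr))
      · obtain ⟨c, hc⟩ := Q.exists_d_pow_mul_a l
        have hcomm : Commute (Q.x s t ^ k) (Q.x 0 1 * Q.x 1 0) := by
          refine Commute.pow_left ?_ k
          have h0 : Commute (Q.x 0 1) (Q.x 1 0) := Q.rel.bc
          fin_cases s <;> fin_cases t <;> simp at hst ⊢
          · exact (Commute.refl _).mul_right h0
          · exact h0.symm.mul_right (Commute.refl _)
        rw [mul_assoc, hc, mul_add, ← mul_assoc, Q.off_pow_mul_a hst, smul_mul_assoc,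
          mul_smul_comm, ← mul_assoc _ (Q.x 0 1 * Q.x 1 0), hcomm.eq, mul_assoc, mul_assoc]
        refine add_mem (Submodule.smul_mem _ _ ?_) (Submodule.smul_mem _ _ ?_)
        · exact a_mul_normal (Q := Q) ⟨s, t, k, l + 1, hst, rfl, rfl, rfl⟩ hn (by simpa using hr)
        · refine bc_mul_normal (Q := Q) ⟨s, t, k, l, hst, rfl, rfl, rfl⟩ ?_ ?_
          · rw [hn]; push_cast; ring
          · rw [hr]; push_cast; ring
    · refine Submodule.mem_sup_left (Submodule.subset_span ⟨s, t, k, l + 1, hst, ?_, ?_, ?_⟩)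
      · push_cast; omega
      · push_cast; simp at hr; omega
      · rw [mul_assoc, pow_succ]
  · rw [mul_assoc, Q.d_pow_mul_off hij, mul_smul_comm, ← mul_assoc]
    refine Submodule.smul_mem _ _ ?_
    by_cases hs : s = i
    · obtain rfl : t = j := by omega
      subst hs
      rw [← pow_succ]
      refine Submodule.mem_sup_left (Submodule.subset_span ⟨s, t, k + 1, l, hst, ?_, ?_, rfl⟩)
      · push_cast; omega
      · push_cast; rw [hr]; ring
    · obtain rfl : t = i := by omega
      obtain rfl : s = j := by omega
      rcases k with _ | k
      · refine Submodule.mem_sup_left (Submodule.subset_span ⟨t, s, 1, l, hij, ?_, ?_, by simp⟩)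
        · rw [hn]; push_cast; ring
        · rw [hr]; push_cast; ring
      · rw [pow_succ, mul_assoc (_ ^ k), hbc s t hst]
        have hcomm : Commute (Q.x s t ^ k) (Q.x 0 1 * Q.x 1 0) := by
          refine Commute.pow_left ?_ k
          have h0 : Commute (Q.x 0 1) (Q.x 1 0) := Q.rel.bc
          fin_cases s <;> fin_cases t <;> simp at hst ⊢
          · exact (Commute.refl _).mul_right h0
          · exact h0.symm.mul_right (Commute.refl _)
        rw [hcomm.eq, mul_assoc]
        refine bc_mul_normal ⟨s, t, k, l, hst, rfl, rfl, rfl⟩ ?_ ?_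
        · rw [hn]; push_cast; ring
        · rw [hr]; push_cast; ring

variable (Q)

lemma coinvSpan_mul_x {n r n' r' : ℤ} {a : M} (h : a ∈ Q.coinvSpan n r) (i j : Fin 2)
    (hn : n' = n + 1) (hr : r' = r + 1 + (j : ℕ) - (i : ℕ)) :
    a * Q.x i j ∈ Q.coinvSpan n' r' := by
  obtain ⟨_, ⟨b, hb, rfl⟩, _, ⟨c, hc, rfl⟩, rfl⟩ := Submodule.mem_sup.1 h
  simp only [LinearMap.mulLeft_apply, add_mul, mul_assoc]
  exact add_mem
    (Q.τ_mul_mem (Q.mul_x_mem_piece hb i j rfl rfl) (by omega) (by omega))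
    (Q.det_mul_mem (Q.mul_x_mem_piece hc i j rfl rfl) (by omega) (by omega))

lemma goodSpan_mul_x {n r n' r' : ℤ} {a : M} (h : a ∈ Q.goodSpan n r) (i j : Fin 2)
    (hn : n' = n + 1) (hr : r' = r + 1 + (j : ℕ) - (i : ℕ)) :
    a * Q.x i j ∈ Q.goodSpan n' r' := by
  obtain ⟨b, hb, c, hc, rfl⟩ := Submodule.mem_sup.1 h
  rw [add_mul]
  refine add_mem ?_ (Submodule.mem_sup_right (Q.coinvSpan_mul_x hc i j hn hr))
  have : Submodule.span ℂ (Q.normalSet n r)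
      ≤ (Q.goodSpan n' r').comap (LinearMap.mulRight ℂ (Q.x i j)) :=
    Submodule.span_le.2 fun g hg => normal_mul_x hg i j hn hr
  exact this hb

lemma piece_le_goodSpan (n r : ℤ) : Q.piece n r ≤ Q.goodSpan n r := by
  have key : ∀ {n r : ℤ} {a : M}, Word Q n r a → a ∈ Q.goodSpan n r := by
    intro n r a h
    induction h with
    | one =>
      exact Submodule.mem_sup_left (Submodule.subset_span ⟨0, 1, 0, 0, by simp, by simp, by simp,
        by simp⟩)
    | mul_x i j h hn hr ih => exact Q.goodSpan_mul_x ih i j hn hr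
  exact Submodule.span_le.2 fun a ha => key ha

lemma low_iterate_coinvSpan {n : ℤ} {r : ℕ} {a : M} (h : a ∈ Q.coinvSpan n r) :
    Q.low^[r] a = 0 := by
  have hmul : ∀ {t : M}, Q.β t = t ⊗ₜ 1 → ∀ b (k : ℕ), Q.low^[k] (t * b) = t * Q.low^[k] b := by
    intro t ht b k
    induction k with
    | zero => rfl
    | succ k ih => rw [Function.iterate_succ_apply', ih, low,
        Q.spannedByCoreps.adOp_coinv_mul ht, ← low, Function.iterate_succ_apply']
  have hz : ∀ {n' r' : ℤ} {b : M}, b ∈ Q.piece n' r' → r' < r → Q.low^[r] b = 0 := by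
    intro n' r' b hb hr
    have := Q.low_iterate_mem hb r
    rw [Q.piece_eq_bot (by omega)] at this
    simpa using this
  obtain ⟨_, ⟨b, hb, rfl⟩, _, ⟨c, hc, rfl⟩, rfl⟩ := Submodule.mem_sup.1 h
  rw [← Module.End.coe_pow, map_add, Module.End.coe_pow, LinearMap.mulLeft_apply,
    LinearMap.mulLeft_apply, hmul Q.β_τ, hmul Q.β_det, hz hb (by omega), hz hc (by omega)]
  simp

lemma piece_le_vec (hqru : (∀ n : ℕ, 0 < n → q ^ n ≠ 1) ∨ q = 1) {n r : ℕ} (hr : r ≤ 2 * n) :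
    Q.piece n r ≤ Submodule.span ℂ {Q.vec n r} ⊔ Q.coinvSpan n r := by
  obtain ⟨c, hc, h⟩ := Q.exists_low_vec hqru hr
  obtain ⟨b, hb, t, ht, hbt⟩ := Submodule.mem_sup.1 (Q.piece_le_goodSpan _ _ (Q.vec_mem n r))
  have hb0 : b ≠ 0 := by
    rintro rfl
    rw [zero_add] at hbt
    rw [← hbt, Q.low_iterate_coinvSpan ht] at h
    exact smul_ne_zero hc (Q.pow_ne_zero' n) h.symm
  have hspan : Submodule.span ℂ (Q.normalSet n r) = Submodule.span ℂ {b} := by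
    rcases (Q.normalSet_subsingleton n r).eq_empty_or_singleton with h | ⟨w, h⟩
    · rw [h, Submodule.span_empty, Submodule.mem_bot] at hb
      exact absurd hb hb0
    · rw [h] at hb ⊢
      obtain ⟨d, rfl⟩ := Submodule.mem_span_singleton.1 hb
      have hd : d ≠ 0 := by rintro rfl; simp at hb0
      exact (Submodule.span_singleton_smul_eq hd.isUnit w).symm
  refine (Q.piece_le_goodSpan _ _).trans (sup_le ?_ le_sup_right)
  rw [hspan, Submodule.span_singleton_le_iff_mem, eq_sub_of_add_eq hbt]
  exact sub_mem (Submodule.mem_sup_left (Submodule.mem_span_singleton_self _))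
    (Submodule.mem_sup_right ht)

/-- The whole algebra is the sum of its pieces. -/
lemma mem_of_piece_le {W : Submodule ℂ M} (h : ∀ n r : ℕ, r ≤ 2 * n → Q.piece n r ≤ W) (a : M) :
    a ∈ W := by
  have ha : a ∈ Submodule.span ℂ
      (Submonoid.closure (Set.range fun p : Fin 2 × Fin 2 => Q.x p.1 p.2) : Set M) := by
    rw [← Algebra.adjoin_eq_span, Q.gen]; trivial
  refine Submodule.span_le.2 (fun b hb => ?_) ha
  obtain ⟨n, r, hw⟩ : ∃ n r, Word Q n r b := by
    induction hb using Submonoid.closure_induction with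
    | mem m hm =>
      obtain ⟨⟨i, j⟩, rfl⟩ := hm
      exact ⟨_, _, Word.x i j⟩
    | one => exact ⟨_, _, Word.one⟩
    | mul m m' _ _ h h' =>
      obtain ⟨_, _, h⟩ := h
      obtain ⟨_, _, h'⟩ := h'
      exact ⟨_, _, h.mul h'⟩
  have hb := hw.bounds
  lift n to ℕ using hb.1
  lift r to ℕ using hb.2.1
  exact h n r (by omega) (Submodule.subset_span hw)

/-- The span of the vectors with `n ≤ m`. -/
def vecSpan (m : ℕ) : Submodule ℂ M :=
  Submodule.span ℂ (Set.range fun p : Fin (m + 1) × Fin (2 * m + 1) => Q.vec p.1 p.2)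

lemma mem_sup_vecSpan (hqru : (∀ n : ℕ, 0 < n → q ^ n ≠ 1) ∨ q = 1) {m : ℕ} {J : Submodule ℂ M}
    {s t : ℂ} (hτ : ∀ h, Q.τ * h - s • h ∈ J) (hdet : ∀ h, Q.det * h - t • h ∈ J)
    (hvec : ∀ n r, m < n → Q.vec n r ∈ J) (a : M) : a ∈ J ⊔ Q.vecSpan m := by
  have key : ∀ N n r : ℕ, n ≤ N → r ≤ 2 * n → Q.piece n r ≤ J ⊔ Q.vecSpan m := by
    intro N
    induction N using Nat.strong_induction_on with
    | _ N ih =>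
    intro n r hn hr
    have hsmall : ∀ (n' r' : ℤ), n' < n → Q.piece n' r' ≤ J ⊔ Q.vecSpan m := by
      intro n' r' hn'
      by_cases hb : n' < 0 ∨ r' < 0 ∨ 2 * n' < r'
      · rw [Q.piece_eq_bot hb]; exact bot_le
      · lift n' to ℕ using by omega
        lift r' to ℕ using by omega
        exact ih n' (by omega) n' r' le_rfl (by omega)
    refine (Q.piece_le_vec hqru hr).trans (sup_le ?_ (sup_le ?_ ?_))
    · rw [Submodule.span_singleton_le_iff_mem]
      by_cases hm : m < n
      · exact Submodule.mem_sup_left (hvec n r hm)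
      · exact Submodule.mem_sup_right (Submodule.subset_span
          ⟨(⟨n, by omega⟩, ⟨r, by omega⟩), rfl⟩)
    · rintro _ ⟨h, hh, rfl⟩
      rw [LinearMap.mulLeft_apply, ← sub_add_cancel (Q.τ * h) (s • h)]
      exact add_mem (Submodule.mem_sup_left (hτ h))
        (Submodule.smul_mem _ _ (hsmall _ _ (by omega) hh))
    · rintro _ ⟨h, hh, rfl⟩
      rw [LinearMap.mulLeft_apply, ← sub_add_cancel (Q.det * h) (t • h)]
      exact add_mem (Submodule.mem_sup_left (hdet h))
        (Submodule.smul_mem _ _ (hsmall _ _ (by omega) hh))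
  exact Q.mem_of_piece_le (fun n r hr => key n n r le_rfl hr) a

lemma eq_zero_of_coorbit (hqru : (∀ n : ℕ, 0 < n → q ^ n ≠ 1) ∨ q = 1) {m : ℕ}
    {e : M →ₐ[ℂ] ℂ} (h01 : e (Q.x 0 1) = 0) (h10 : e (Q.x 1 0) = 0)
    (hnz : ∀ k : ℕ, k < m → e (Q.x 0 0) - q ^ (2 * k) * e (Q.x 1 1) ≠ 0) (A : ℕ)
    (c : ℕ → ℕ → ℂ)
    (h0 : coorbit e Q.β (∑ r ∈ Finset.range A, ∑ n ∈ Finset.range (m + 1), c n r • Q.vec n r) = 0) :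
    ∑ r ∈ Finset.range A, ∑ n ∈ Finset.range (m + 1), c n r • Q.vec n r = 0 := by
  induction A with
  | zero => simp
  | succ A ih =>
    have h1 := Q.coorbit_low e
      (∑ r ∈ Finset.range (A + 1), ∑ n ∈ Finset.range (m + 1), c n r • Q.vec n r) A
    have h2 : ∀ r ∈ Finset.range A, ∀ n ∈ Finset.range (m + 1),
        c n r • Q.low^[A] (Q.vec n r) = 0 := fun r hr n _ => by
      rw [Q.low_iterate_vec (Finset.mem_range.1 hr), smul_zero]
    rw [h0, ← Module.End.coe_pow, ← Module.End.coe_pow, map_zero] at h1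
    simp only [map_sum, map_smul, Finset.sum_range_succ _ A, Module.End.coe_pow, map_add] at h1
    rw [Finset.sum_eq_zero fun r hr => Finset.sum_eq_zero fun n hn => by
      rw [← map_smul, h2 r hr n hn, map_zero], zero_add] at h1
    have hcoef : ∀ n ∈ Finset.range (m + 1), ∃ d : ℂ, (d = 0 → Q.vec n A = 0) ∧
        coorbit e Q.β (Q.low^[A] (Q.vec n A)) = d • Q.hw n := by
      intro n hn
      by_cases hA : A ≤ 2 * n
      · obtain ⟨κ, hκ, h⟩ := Q.exists_low_vec hqru hA
        refine ⟨_, fun hd => ?_, by rw [h, map_smul, Q.coorbit_pow e h01 h10, smul_smul]⟩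
        refine absurd hd (mul_ne_zero hκ (Finset.prod_ne_zero_iff.2 fun k hk => ?_))
        rw [Finset.mem_range] at hn hk
        exact mul_ne_zero (neg_ne_zero.2 Q.q_ne) (hnz k (by omega))
      · exact ⟨0, fun _ => Q.vec_eq_zero (by omega), by
          rw [Q.vec_eq_zero (by omega), ← Module.End.coe_pow]; simp⟩
    choose! d hd hd' using hcoef
    obtain ⟨f, hf⟩ := Q.exists_dual
    have htop : ∑ n ∈ Finset.range (m + 1), c n A • Q.vec n A = 0 := by
      refine Finset.sum_eq_zero fun n hn => ?_
      have h3 := congrArg (f n) h1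
      rw [Finset.sum_congr rfl fun n hn => by rw [hd' n hn]] at h3
      simp only [map_sum, map_smul, hf, smul_eq_mul, mul_ite, mul_one, mul_zero, map_zero,
        Finset.sum_ite_eq, hn, if_true] at h3
      rcases mul_eq_zero.1 h3 with h | h
      · rw [h, zero_smul]
      · rw [hd n hn h, smul_zero]
    rw [Finset.sum_range_succ, htop, add_zero] at h0 ⊢
    exact ih h0

lemma mem_vecSpan_eq_zero (hqru : (∀ n : ℕ, 0 < n → q ^ n ≠ 1) ∨ q = 1) {m : ℕ}
    {e : M →ₐ[ℂ] ℂ} (h01 : e (Q.x 0 1) = 0) (h10 : e (Q.x 1 0) = 0)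
    (hnz : ∀ k : ℕ, k < m → e (Q.x 0 0) - q ^ (2 * k) * e (Q.x 1 1) ≠ 0) {a : M}
    (ha : a ∈ Q.vecSpan m) (h0 : coorbit e Q.β a = 0) : a = 0 := by
  obtain ⟨c, rfl⟩ := (Submodule.mem_span_range_iff_exists_fun ℂ).1 ha
  let c' : ℕ → ℕ → ℂ := fun n r =>
    if h : n < m + 1 ∧ r < 2 * m + 1 then c (⟨n, h.1⟩, ⟨r, h.2⟩) else 0
  have : ∑ p : Fin (m + 1) × Fin (2 * m + 1), c p • Q.vec p.1 p.2
      = ∑ r ∈ Finset.range (2 * m + 1), ∑ n ∈ Finset.range (m + 1), c' n r • Q.vec n r := by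
    rw [Fintype.sum_prod_type_right, Finset.sum_range]
    refine Finset.sum_congr rfl fun r _ => ?_
    rw [Finset.sum_range]
    refine Finset.sum_congr rfl fun n _ => ?_
    rw [show c' n r = c (n, r) from dif_pos ⟨n.2, r.2⟩]
  rw [this] at h0 ⊢
  exact Q.eq_zero_of_coorbit hqru h01 h10 hnz _ _ h0

/-- The kernel of the coorbit map at a degenerate diagonal point. -/
theorem ker_coorbit (hqru : (∀ n : ℕ, 0 < n → q ^ n ≠ 1) ∨ q = 1) {m : ℕ}
    {e : M →ₐ[ℂ] ℂ} (h01 : e (Q.x 0 1) = 0) (h10 : e (Q.x 1 0) = 0)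
    (hnz : ∀ k : ℕ, k < m → e (Q.x 0 0) - q ^ (2 * k) * e (Q.x 1 1) ≠ 0)
    (hz : e (Q.x 0 0) - q ^ (2 * m) * e (Q.x 1 1) = 0) :
    LinearMap.ker (coorbit e Q.β)
      = Submodule.span ℂ {y : M | ∃ h : M, y = (Q.τ - algebraMap ℂ M (e Q.τ)) * h ∨
          y = (Q.det - algebraMap ℂ M (e Q.det)) * h}
        ⊔ comodGen Q.β {y : M | ∃ k : ℕ, m < k ∧ y = Q.x 1 0 ^ k} := by
  set I := Submodule.span ℂ {y : M | ∃ h : M, y = (Q.τ - algebraMap ℂ M (e Q.τ)) * h ∨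
      y = (Q.det - algebraMap ℂ M (e Q.det)) * h} with hI
  set P := comodGen Q.β {y : M | ∃ k : ℕ, m < k ∧ y = Q.x 1 0 ^ k} with hP
  have hle : I ⊔ P ≤ LinearMap.ker (coorbit e Q.β) := by
    refine sup_le (Submodule.span_le.2 ?_) (Q.spannedByCoreps.comodGen_le_ker e ?_)
    · rintro _ ⟨h, rfl | rfl⟩
      · simp [sub_mul, ← Algebra.smul_def, Q.spannedByCoreps.coorbit_coinv_mul e Q.β_τ]
      · simp [sub_mul, ← Algebra.smul_def, Q.spannedByCoreps.coorbit_coinv_mul e Q.β_det]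
    · rintro _ ⟨k, hk, rfl⟩
      rw [SetLike.mem_coe, LinearMap.mem_ker, Q.coorbit_pow e h01 h10,
        Finset.prod_eq_zero (Finset.mem_range.2 hk) (by rw [hz, mul_zero]), zero_smul]
  refine le_antisymm (fun a ha => ?_) hle
  have hτ : ∀ h, Q.τ * h - e Q.τ • h ∈ I := fun h =>
    Submodule.subset_span ⟨h, Or.inl (by rw [sub_mul, Algebra.smul_def])⟩
  have hdet : ∀ h, Q.det * h - e Q.det • h ∈ I := fun h =>
    Submodule.subset_span ⟨h, Or.inr (by rw [sub_mul, Algebra.smul_def])⟩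
  have hvec : ∀ n r, m < n → Q.vec n r ∈ P := by
    intro n r hn
    induction r with
    | zero => exact HopfPair.subset_comodGen _ _ ⟨n, hn, rfl⟩
    | succ r ih =>
      rw [vec, Function.iterate_succ_apply', ← vec]
      exact Q.adOp_mem_comodGen _ _ ih
  obtain ⟨j, hj, v, hv, rfl⟩ := Submodule.mem_sup.1 (Q.mem_sup_vecSpan hqru
    (fun h => Submodule.mem_sup_left (hτ h)) (fun h => Submodule.mem_sup_left (hdet h))
    (fun n r hn => Submodule.mem_sup_right (hvec n r hn)) a)
  have hv0 : coorbit e Q.β v = 0 := by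
    rw [LinearMap.mem_ker, map_add, LinearMap.mem_ker.1 (hle hj), zero_add] at ha
    exact ha
  rw [Q.mem_vecSpan_eq_zero hqru h01 h10 hnz hv hv0, add_zero]
  exact hj

end QuantumGL2

lemma qdet_eq_qdet₂ {M : Type} [Ring M] [Algebra ℂ M] (q : ℂ) (x : Fin 2 → Fin 2 → M) :
    qdet q x = qdet₂ q x := by
  have key : ∀ (n : ℕ) (hn : n = 2) (f : Fin n ≃o (Finset.univ : Finset (Fin 2))),
      ∑ σ : Equiv.Perm (Fin n), ((-q) ^ invCount σ) •
        ((List.finRange n).map fun k => x (f k).1 (f (σ k)).1).prod = qdet₂ q x := by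
    rintro _ rfl f
    have h01 : (f 0).1 < (f 1).1 := f.strictMono Fin.zero_lt_one
    have h0 : (f 0).1 = 0 := by omega
    have h1 : (f 1).1 = 1 := by omega
    have hid : invCount (1 : Equiv.Perm (Fin 2)) = 0 := by decide
    have hsw : invCount (Equiv.swap (0 : Fin 2) 1) = 1 := by decide
    have huniv : (Finset.univ : Finset (Equiv.Perm (Fin 2))) = {1, Equiv.swap 0 1} := by decide
    have hne : (1 : Equiv.Perm (Fin 2)) ≠ Equiv.swap 0 1 := by decide
    rw [huniv, Finset.sum_pair hne, hid, hsw]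
    simp [List.finRange_succ, h0, h1, qdet₂, sub_eq_add_neg]
  exact key _ (Finset.card_fin 2) _

/-- `N = 2`, `q` not a root of unity, `ξ = diag(ξ₁, ξ₂)` with `ξ₁ - q^(2k) ξ₂ ≠ 0`
for `k < m` and `ξ₁ - q^(2m) ξ₂ = 0`: the kernel of `β^ξ` is the sum of the right
ideal generated by `τᵢ - τᵢ(ξ)` and the subcomodule generated by the `x₂₁^k`, `k > m`. -/
theorem ker_coorbit_beta_2x2_degenerate
    (q : ℂ) (hq : q ≠ 0) (hqru : (∀ n : ℕ, 0 < n → q ^ n ≠ 1) ∨ q = 1)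
    (M G : Type) [Ring M] [Algebra ℂ M] [Ring G] [Algebra ℂ G]
    (x : Fin 2 → Fin 2 → M)
    (hrow : ∀ i j l : Fin 2, j < l → x i j * x i l = (q) • (x i l * x i j))
    (hcol : ∀ i k j : Fin 2, i < k → x i j * x k j = (q) • (x k j * x i j))
    (hanti : ∀ i k j l : Fin 2, i < k → j < l → x i l * x k j = x k j * x i l)
    (hdiag : ∀ i k j l : Fin 2, i < k → j < l →
      x i j * x k l - x k l * x i j = ((q) - (q⁻¹)) • (x i l * x k j))
    (hgen : Algebra.adjoin ℂ (Set.range fun p : Fin 2 × Fin 2 => x p.1 p.2) = ⊤)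
    (hfree : ∀ (B : Type) [Ring B] [Algebra ℂ B] (y : Fin 2 → Fin 2 → B),
      (∀ i j l : Fin 2, j < l → y i j * y i l = (q) • (y i l * y i j)) →
      (∀ i k j : Fin 2, i < k → y i j * y k j = (q) • (y k j * y i j)) →
      (∀ i k j l : Fin 2, i < k → j < l → y i l * y k j = y k j * y i l) →
      (∀ i k j l : Fin 2, i < k → j < l →
        y i j * y k l - y k l * y i j = ((q) - (q⁻¹)) • (y i l * y k j)) →
      ∃! φ : M →ₐ[ℂ] B, ∀ i j, φ (x i j) = y i j)
    (ι : M →ₐ[ℂ] G) (dInv : G)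
    (hd1 : ι (qdet (q) x) * dInv = 1)
    (hd2 : dInv * ι (qdet (q) x) = 1)
    (hgenG : Algebra.adjoin ℂ
      (Set.range (fun p : Fin 2 × Fin 2 => ι (x p.1 p.2)) ∪ {dInv}) = ⊤)
    (hfreeG : ∀ (B : Type) [Ring B] [Algebra ℂ B] (φ : M →ₐ[ℂ] B) (u : B),
      φ (qdet (q) x) * u = 1 → u * φ (qdet (q) x) = 1 →
      ∃! ψ : G →ₐ[ℂ] B, ψ.comp ι = φ)
    (ΔM : M →ₐ[ℂ] M ⊗[ℂ] M)
    (hΔM : ∀ i j, ΔM (x i j) = ∑ k, x i k ⊗ₜ[ℂ] x k j)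
    (ΔG : G →ₐ[ℂ] G ⊗[ℂ] G)
    (hΔG : ∀ m, ΔG (ι m) = Algebra.TensorProduct.map ι ι (ΔM m))
    (εG : G →ₐ[ℂ] ℂ)
    (hεG : ∀ i j, εG (ι (x i j)) = if i = j then 1 else 0)
    (St : G →ₗ[ℂ] G)
    (hS1 : LinearMap.mul' ℂ G ∘ₗ TensorProduct.map St LinearMap.id ∘ₗ ΔG.toLinearMap
      = Algebra.linearMap ℂ G ∘ₗ εG.toLinearMap)
    (hS2 : LinearMap.mul' ℂ G ∘ₗ TensorProduct.map LinearMap.id St ∘ₗ ΔG.toLinearMap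
      = Algebra.linearMap ℂ G ∘ₗ εG.toLinearMap)
    (ξ1 ξ2 : ℂ) (e : M →ₐ[ℂ] ℂ)
    (he00 : e (x 0 0) = ξ1) (he01 : e (x 0 1) = 0)
    (he10 : e (x 1 0) = 0) (he11 : e (x 1 1) = ξ2)
    (m : ℕ) (hnz : ∀ k : ℕ, k < m → ξ1 - q ^ (2 * k) * ξ2 ≠ 0)
    (hz : ξ1 - q ^ (2 * m) * ξ2 = 0) :
    LinearMap.ker (coorbit e (adjBeta ΔM ι St))
      = Submodule.span ℂ {y : M | ∃ h : M,
          y = (((q ^ 2)⁻¹ • x 0 0 + (q ^ 4)⁻¹ • x 1 1) - algebraMap ℂ M (e ((q ^ 2)⁻¹ • x 0 0 + (q ^ 4)⁻¹ • x 1 1))) * h ∨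
          y = ((x 0 0 * x 1 1 - q • (x 0 1 * x 1 0)) - algebraMap ℂ M (e (x 0 0 * x 1 1 - q • (x 0 1 * x 1 0)))) * h}
        ⊔ comodGen (adjBeta ΔM ι St) {y : M | ∃ k : ℕ, m < k ∧ y = x 1 0 ^ k} := by
  have hqdet : qdet q x = qdet₂ q x := qdet_eq_qdet₂ q x
  rw [hqdet] at hd1 hd2 hfreeG
  let Q : QuantumGL2 q M G :=
    { ι := ι, comulM := ΔM, comul := ΔG, counit := εG, anti := St, comul_ι := hΔG
      anti_conv := hS1, conv_anti := hS2, x := x, dInv := dInv, q_ne := hq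
      rel := ⟨hrow 0 0 1 Fin.zero_lt_one, hrow 1 0 1 Fin.zero_lt_one, hcol 0 1 0 Fin.zero_lt_one,
        hcol 0 1 1 Fin.zero_lt_one, hanti 0 1 0 1 Fin.zero_lt_one Fin.zero_lt_one,
        hdiag 0 1 0 1 Fin.zero_lt_one Fin.zero_lt_one⟩
      gen := hgen
      free := fun B _ _ y hy => by
        have hlt : ∀ {i j : Fin 2}, i < j → i = 0 ∧ j = 1 := by omega
        refine (hfree B y (fun i j l h => ?_) (fun i k j h => ?_) (fun i k j l h h' => ?_)
          (fun i k j l h h' => ?_)).exists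
        · obtain ⟨rfl, rfl⟩ := hlt h
          fin_cases i
          exacts [hy.ab, hy.cd]
        · obtain ⟨rfl, rfl⟩ := hlt h
          fin_cases j
          exacts [hy.ac, hy.bd]
        · obtain ⟨rfl, rfl⟩ := hlt h
          obtain ⟨rfl, rfl⟩ := hlt h'
          exact hy.bc
        · obtain ⟨rfl, rfl⟩ := hlt h
          obtain ⟨rfl, rfl⟩ := hlt h'
          exact hy.ad
      det_mul := hd1, mul_det := hd2
      freeG := fun B _ _ φ u h h' => (hfreeG B φ u h h').exists
      comul_x := hΔM, counit_x := hεG }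
  subst he00 he11
  exact Q.ker_coorbit hqru he01 he10 hnz hz

end
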